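/- arXiv:2310.02271 — 3 statements merged into one kernel-verified Lean document; each statement's English description precedes it below -/
import Mathlib

section
/- For each wave speed c with c² > π², there exists a strictly increasing function φ: ℝ → ℝ with lim_{s→−∞} φ(s) = −1/2 and lim_{s→+∞} φ(s) = 1/2, satisfying the relation (c² − π²)(s − φ(s)) = π·tan(π·φ(s)) for all s ∈ ℝ, such that the particle positions x_j(t) := j − φ(j − c t), j ∈ ℤ, form a solitary-wave solution of the infinite Calogero-Moser lattice: for every j ∈ ℤ and t ∈ ℝ, t ↦ x_j(t) is twice differentiable, the series Σ_{k∈ℤ, k≠j} 2/(x_j(t) − x_k(t))³ converges absolutely, and ẍ_j(t) = Σ_{k∈ℤ, k≠j} 2/(x_j(t) − x_k(t))³. -/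
open Real Filter Topology

/-- The distance from a non-integer real number to the integers is positive. -/
lemma exists_pos_le_abs_sub_intCast {x : ℝ} (hx : ∀ m : ℤ, x ≠ m) :
    ∃ ε > 0, ∀ m : ℤ, ε ≤ |x - m| := by
  have h : (Set.range ((↑) : ℤ → ℝ))ᶜ ∈ 𝓝 x :=
    Int.isClosedEmbedding_coe_real.isClosed_range.isOpen_compl.mem_nhds
      (by rintro ⟨m, rfl⟩; exact hx m rfl)
  obtain ⟨ε, hε, hb⟩ := Metric.mem_nhds_iff.1 h
  refine ⟨ε, hε, fun m => ?_⟩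
  by_contra! hm
  exact hb (show (m : ℝ) ∈ Metric.ball x ε by rwa [Metric.mem_ball, dist_comm, Real.dist_eq]) ⟨m, rfl⟩

lemma summable_inv_sub_intCast_pow (x : ℝ) {r : ℕ} (hr : 2 ≤ r) :
    Summable fun m : ℤ => |((x - m) ^ r)⁻¹| := by
  have h := (Real.summable_one_div_int_add_rpow (-x) r).2 (by exact_mod_cast hr)
  refine h.congr fun m => ?_
  rw [Real.rpow_natCast, abs_inv, abs_pow, one_div, abs_sub_comm]
  rfl

lemma summable_inv_mul_inv_sub_intCast (x y : ℝ) :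
    Summable fun m : ℤ => (x - m)⁻¹ * (y - m)⁻¹ := by
  refine Summable.of_norm_bounded (g := fun m : ℤ => |((x - m) ^ 2)⁻¹| + |((y - m) ^ 2)⁻¹|)
    ((summable_inv_sub_intCast_pow x le_rfl).add (summable_inv_sub_intCast_pow y le_rfl)) fun m => ?_
  rw [Real.norm_eq_abs, ← inv_pow, ← inv_pow, abs_mul, abs_pow, abs_pow]
  generalize |(x - m)⁻¹| = a
  generalize |(y - m)⁻¹| = b
  nlinarith [sq_nonneg (a - b), sq_nonneg (a + b)]

lemma hasDerivAt_tsum_inv_sub_intCast_pow {x : ℝ} (hx : ∀ m : ℤ, x ≠ m) {r : ℕ} (hr : 1 ≤ r)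
    (a : ℤ → ℝ) (hs : Summable fun m : ℤ => ((x - m) ^ r)⁻¹ - a m) :
    HasDerivAt (fun y : ℝ => ∑' m : ℤ, (((y - m) ^ r)⁻¹ - a m))
      (-r * ∑' m : ℤ, ((x - m) ^ (r + 1))⁻¹) x := by
  obtain ⟨ε, hε, hm⟩ := exists_pos_le_abs_sub_intCast hx
  have hx0 : x ∈ Metric.ball x (ε / 2) := Metric.mem_ball_self (half_pos hε)
  have hlow : ∀ y ∈ Metric.ball x (ε / 2), ∀ m : ℤ, |x - m| / 2 ≤ |y - m| ∧ 0 < |y - m| := by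
    intro y hy m
    rw [Metric.mem_ball, Real.dist_eq] at hy
    have h1 := abs_sub_abs_le_abs_sub (x - m) (x - y)
    have h2 : x - m - (x - y) = y - m := by ring
    rw [h2, abs_sub_comm x y] at h1
    have := hm m
    constructor <;> linarith
  rw [← tsum_mul_left]
  refine hasDerivAt_tsum_of_isPreconnected
    (g' := fun (m : ℤ) (y : ℝ) => -r * ((y - m) ^ (r + 1))⁻¹)
    (u := fun m : ℤ => r * (2 ^ (r + 1) * |((x - m) ^ (r + 1))⁻¹|))
    (((summable_inv_sub_intCast_pow x (by omega)).mul_left _).mul_left _) Metric.isOpen_ball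
    (convex_ball x (ε / 2)).isPreconnected (fun m y hy => ?_) (fun m y hy => ?_) hx0 hs hx0
  · have h0 : y - m ≠ 0 := abs_pos.1 (hlow y hy m).2
    have h1 := (((hasDerivAt_id' y).sub_const (m : ℝ)).fun_pow r).fun_inv (pow_ne_zero r h0)
    refine (h1.sub_const (a m)).congr_deriv ?_
    obtain ⟨k, rfl⟩ : ∃ k, r = k + 1 := ⟨r - 1, by omega⟩
    rw [Nat.add_sub_cancel]
    field_simp
    ring
  · obtain ⟨h1, h2⟩ := hlow y hy m
    have h3 : 0 < |x - m| := hε.trans_le (hm m)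
    rw [Real.norm_eq_abs, abs_mul, abs_neg, Nat.abs_cast, abs_inv, abs_inv, abs_pow, abs_pow]
    gcongr
    calc (|y - m| ^ (r + 1))⁻¹ ≤ ((|x - m| / 2) ^ (r + 1))⁻¹ := by gcongr
      _ = _ := by rw [div_pow, inv_div, div_eq_mul_inv]

lemma mem_integerComplement_ofReal {x : ℝ} (hx : ∀ m : ℤ, x ≠ m) :
    (x : ℂ) ∈ Complex.integerComplement := by
  rintro ⟨m, hm⟩
  exact hx m (by exact_mod_cast hm.symm)

/-- The cotangent series on the real line. -/
lemma hasSum_real_cotTerm {x : ℝ} (hx : ∀ m : ℤ, x ≠ m) :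
    HasSum (fun n : ℕ => (x - (n + 1))⁻¹ + (x + (n + 1))⁻¹) (π * cot (π * x) - x⁻¹) := by
  have h := (summable_cotTerm (mem_integerComplement_ofReal hx)).hasSum
  rw [← cot_series_rep' (mem_integerComplement_ofReal hx)] at h
  rw [← Complex.hasSum_ofReal]
  push_cast
  simpa [cotTerm] using h

/-- The partial fraction expansion of the cotangent, in a form that converges absolutely. -/
lemma hasSum_inv_sub_intCast_sub {x y : ℝ} (hx : ∀ m : ℤ, x ≠ m) (hy : ∀ m : ℤ, y ≠ m) :
    HasSum (fun m : ℤ => (x - m)⁻¹ - (y - m)⁻¹) (π * cot (π * x) - π * cot (π * y)) := by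
  have hs : Summable fun m : ℤ => (x - m)⁻¹ - (y - m)⁻¹ := by
    refine ((summable_inv_mul_inv_sub_intCast x y).mul_left (y - x)).congr fun m => ?_
    have h1 : x - m ≠ 0 := sub_ne_zero.2 (hx m)
    have h2 : y - m ≠ 0 := sub_ne_zero.2 (hy m)
    field_simp
    ring
  have h1 := hs.hasSum.nat_add_neg
  have h2 := (hasSum_nat_add_iff' 1).2 h1
  have h3 := (hasSum_real_cotTerm hx).sub (hasSum_real_cotTerm hy)
  have h4 := h2.unique (h3.congr_fun fun n => ?_)
  · convert hs.hasSum using 1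
    simp at h4
    linarith
  · push_cast
    simp only [sub_neg_eq_add]
    ring

lemma sin_pi_mul_ne_zero_of_ne_intCast {x : ℝ} (hx : ∀ m : ℤ, x ≠ m) : sin (π * x) ≠ 0 := by
  rw [Ne, Real.sin_eq_zero_iff]
  rintro ⟨m, hm⟩
  refine hx m (mul_left_cancel₀ pi_ne_zero ?_)
  rw [← hm, mul_comm]

lemma hasDerivAt_cot_pi_mul {x : ℝ} (hx : ∀ m : ℤ, x ≠ m) :
    HasDerivAt (fun y => cot (π * y)) (-(π * (1 + cot (π * x) ^ 2))) x := by
  have hs := sin_pi_mul_ne_zero_of_ne_intCast hx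
  have h1 : HasDerivAt (fun y : ℝ => π * y) π x := by
    simpa using (hasDerivAt_id' x).const_mul π
  simp only [cot_eq_cos_div_sin]
  refine (h1.cos.div h1.sin hs).congr_deriv ?_
  field_simp
  ring

lemma eventually_ne_intCast {x : ℝ} (hx : ∀ m : ℤ, x ≠ m) : ∀ᶠ y : ℝ in 𝓝 x, ∀ m : ℤ, y ≠ m := by
  have h : (Set.range ((↑) : ℤ → ℝ))ᶜ ∈ 𝓝 x :=
    Int.isClosedEmbedding_coe_real.isClosed_range.isOpen_compl.mem_nhds
      (by rintro ⟨m, rfl⟩; exact hx m rfl)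
  filter_upwards [h] with y hy m hm
  exact hy ⟨m, hm.symm⟩

/-- Differentiating a formula for `∑ (y - m)⁻ʳ` in terms of the cotangent gives one for
`∑ (y - m)⁻ʳ⁻¹`. -/
lemma tsum_inv_sub_intCast_pow_succ {r : ℕ} (hr : 2 ≤ r) {g : ℝ → ℝ}
    (hg : ∀ y : ℝ, (∀ m : ℤ, y ≠ m) → ∑' m : ℤ, ((y - m) ^ r)⁻¹ = g (cot (π * y)))
    {x g' : ℝ} (hx : ∀ m : ℤ, x ≠ m) (hg' : HasDerivAt g g' (cot (π * x))) :
    r * ∑' m : ℤ, ((x - m) ^ (r + 1))⁻¹ = g' * (π * (1 + cot (π * x) ^ 2)) := by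
  have h1 := hasDerivAt_tsum_inv_sub_intCast_pow hx (by omega : 1 ≤ r) 0
    (by simpa using (summable_inv_sub_intCast_pow x hr).of_abs)
  simp only [Pi.zero_apply, sub_zero] at h1
  have h2 := (hg'.comp x (hasDerivAt_cot_pi_mul hx)).congr_of_eventuallyEq
    ((eventually_ne_intCast hx).mono fun y hy => hg y hy)
  linarith [h1.unique h2]

lemma tsum_inv_sub_intCast_sq {x : ℝ} (hx : ∀ m : ℤ, x ≠ m) :
    ∑' m : ℤ, ((x - m) ^ 2)⁻¹ = π ^ 2 * (1 + cot (π * x) ^ 2) := by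
  have h1 := hasDerivAt_tsum_inv_sub_intCast_pow hx le_rfl (fun m : ℤ => (x - m)⁻¹)
    (by simp)
  have h2 := ((hasDerivAt_cot_pi_mul hx).const_mul π).sub_const (π * cot (π * x))
  have h3 := h2.congr_of_eventuallyEq (((eventually_ne_intCast hx).mono fun y hy =>
    show ∑' m : ℤ, (((y - m) ^ 1)⁻¹ - (x - m)⁻¹) = _ by
      simpa using (hasSum_inv_sub_intCast_sub hy hx).tsum_eq))
  have h4 := h1.unique h3
  norm_num at h4
  linarith

lemma tsum_inv_sub_intCast_cube {x : ℝ} (hx : ∀ m : ℤ, x ≠ m) :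
    ∑' m : ℤ, ((x - m) ^ 3)⁻¹ = π ^ 3 * (cot (π * x) * (1 + cot (π * x) ^ 2)) := by
  have h := tsum_inv_sub_intCast_pow_succ (g := fun u => π ^ 2 * (1 + u ^ 2)) le_rfl
    (fun y hy => tsum_inv_sub_intCast_sq hy) hx
    ((((hasDerivAt_id' _).fun_pow 2).const_add 1).const_mul (π ^ 2))
  norm_num at h
  linarith

lemma tsum_inv_sub_intCast_pow_four {x : ℝ} (hx : ∀ m : ℤ, x ≠ m) :
    ∑' m : ℤ, ((x - m) ^ 4)⁻¹ =
      π ^ 4 * ((1 + cot (π * x) ^ 2) * (1 + 3 * cot (π * x) ^ 2) / 3) := by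
  have h := tsum_inv_sub_intCast_pow_succ (g := fun u => π ^ 3 * (u * (1 + u ^ 2)))
    (by norm_num) (fun y hy => tsum_inv_sub_intCast_cube hy) hx
    (((hasDerivAt_id' _).fun_mul (((hasDerivAt_id' _).fun_pow 2).const_add 1)).const_mul (π ^ 3))
  norm_num at h
  linarith

lemma tsum_inv_sub_intCast_pow_five {x : ℝ} (hx : ∀ m : ℤ, x ≠ m) :
    ∑' m : ℤ, ((x - m) ^ 5)⁻¹ =
      π ^ 5 * (cot (π * x) * (1 + cot (π * x) ^ 2) * (2 + 3 * cot (π * x) ^ 2) / 3) := by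
  have h := tsum_inv_sub_intCast_pow_succ
    (g := fun u => π ^ 4 * ((1 + u ^ 2) * (1 + 3 * u ^ 2) / 3))
    (by norm_num) (fun y hy => tsum_inv_sub_intCast_pow_four hy) hx
    (((((((hasDerivAt_id' _).fun_pow 2).const_add 1).fun_mul
      ((((hasDerivAt_id' _).fun_pow 2).const_mul 3).const_add 1)).div_const 3)).const_mul (π ^ 4))
  norm_num at h
  linarith

/-- The bilinear form of the cotangent series. -/
lemma hasSum_inv_mul_inv_sub_intCast {x y : ℝ} (hx : ∀ m : ℤ, x ≠ m) (hy : ∀ m : ℤ, y ≠ m)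
    (hxy : x ≠ y) :
    HasSum (fun m : ℤ => (x - m)⁻¹ * (y - m)⁻¹)
      ((π * cot (π * x) - π * cot (π * y)) / (y - x)) := by
  have h0 : y - x ≠ 0 := sub_ne_zero.2 hxy.symm
  refine ((hasSum_inv_sub_intCast_sub hx hy).div_const (y - x)).congr_fun fun m => ?_
  have h1 : x - m ≠ 0 := sub_ne_zero.2 (hx m)
  have h2 : y - m ≠ 0 := sub_ne_zero.2 (hy m)
  field_simp
  ring

lemma isCompactOperator_of_diagonal {ι : Type*} {a : ι → ℝ} (ha : Tendsto a cofinite (𝓝 0))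
    (D : lp (fun _ : ι => ℝ) 2 →L[ℝ] lp (fun _ : ι => ℝ) 2) (hD : ∀ f i, D f i = a i * f i) :
    IsCompactOperator D := by
  classical
  let F : Finset ι → lp (fun _ : ι => ℝ) 2 →L[ℝ] lp (fun _ : ι => ℝ) 2 := fun S =>
    ∑ i ∈ S, (lp.singleContinuousLinearMap ℝ (fun _ : ι => ℝ) 2 i).comp
      (a i • lp.evalCLM ℝ (fun _ : ι => ℝ) 2 i)
  have hF : ∀ S f i, F S f i = if i ∈ S then a i * f i else 0 := by
    intro S f i
    simp only [F, sum_apply, lp.coeFn_sum, Finset.sum_apply]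
    simp [Pi.single_apply, lp.evalCLM, lp.evalₗ]
    rfl
  refine isCompactOperator_of_tendsto (l := atTop) (F := F) ?_ (Eventually.of_forall fun S => ?_)
  · rw [Metric.tendsto_atTop]
    intro ε hε
    have hfin : {i | ¬ |a i| < ε / 2}.Finite := by
      have := ha.eventually (Metric.ball_mem_nhds 0 (half_pos hε))
      simpa [Filter.eventually_cofinite] using this
    refine ⟨hfin.toFinset, fun S hS => ?_⟩
    rw [dist_eq_norm]
    refine lt_of_le_of_lt (ContinuousLinearMap.opNorm_le_bound _ (half_pos hε).le fun f => ?_)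
      (half_lt_self hε)
    have h1 : ε / 2 * ‖f‖ = ‖(ε / 2) • f‖ := by
      rw [norm_smul, Real.norm_eq_abs, abs_of_pos (half_pos hε)]
    rw [h1]
    refine lp.norm_mono (by norm_num) fun i => ?_
    rw [sub_apply, lp.coeFn_sub, Pi.sub_apply, hF, hD, lp.coeFn_smul,
      Pi.smul_apply, smul_eq_mul, norm_mul, Real.norm_eq_abs (ε / 2), abs_of_pos (half_pos hε)]
    split_ifs with hi
    · simp only [sub_self, norm_zero]
      positivity
    · have h2 : |a i| < ε / 2 := by
        by_contra h
        exact hi (hS (hfin.mem_toFinset.2 h))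
      rw [zero_sub, norm_neg, norm_mul, Real.norm_eq_abs (a i)]
      gcongr
  · refine Submodule.sum_mem (compactOperator (RingHom.id ℝ) (lp (fun _ : ι => ℝ) 2)
      (lp (fun _ : ι => ℝ) 2)) fun i _ => ?_
    have h1 : IsCompactOperator (a i • lp.evalCLM ℝ (fun _ : ι => ℝ) 2 i) :=
      isCompactOperator_of_locallyCompactSpace_dom _
    exact h1.clm_comp (lp.singleContinuousLinearMap ℝ (fun _ : ι => ℝ) 2 i)

section
variable {E : Type*} [NormedAddCommGroup E] [InnerProductSpace ℝ E]
open scoped InnerProductSpace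

/-- The spectral theorem for the compression of a compact symmetric operator to the
orthogonal complement of a unit vector `n`. -/
lemma eq_zero_of_inner_compression_eigenvectors_eq_zero [CompleteSpace E] {D : E →L[ℝ] E}
    (hc : IsCompactOperator D)
    (hs : ∀ x y, ⟪D x, y⟫_ℝ = ⟪x, D y⟫_ℝ) {n : E} (hn : ⟪n, n⟫_ℝ = 1) {x : E}
    (hx : ⟪n, x⟫_ℝ = 0)
    (h : ∀ (y : E) (v μ : ℝ), ⟪n, y⟫_ℝ = 0 → D y = v • y + μ • n → ⟪y, x⟫_ℝ = 0) : x = 0 := by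
  let P : E →L[ℝ] E := ContinuousLinearMap.id ℝ E - (innerSL ℝ n).smulRight n
  have hP : ∀ y, P y = y - ⟪n, y⟫_ℝ • n := fun y => by simp [P]
  have hPs : ∀ y z, ⟪P y, z⟫_ℝ = ⟪y, P z⟫_ℝ := fun y z => by
    simp only [hP, inner_sub_left, inner_sub_right, real_inner_smul_left, real_inner_smul_right]
    rw [real_inner_comm n y]
    ring
  have hPn : ∀ y, ⟪n, P y⟫_ℝ = 0 := fun y => by
    simp only [hP, inner_sub_right, real_inner_smul_right, hn]
    ring
  let V : E →L[ℝ] E := P.comp (D.comp P)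
  have hV : ∀ y, V y = P (D (P y)) := fun y => rfl
  have hVc : IsCompactOperator V := (hc.comp_clm P).clm_comp P
  have hVs : (V : E →ₗ[ℝ] E).IsSymmetric := fun y z => by
    simp only [ContinuousLinearMap.coe_coe, hV, hPs, hs]
  have hbot := ContinuousLinearMap.orthogonalComplement_iSup_eigenspaces_eq_bot hVc hVs
  suffices hle : ⨆ v, Module.End.eigenspace (V : Module.End ℝ E) v ≤ (ℝ ∙ x)ᗮ by
    rw [← Submodule.mem_bot ℝ, ← hbot, Submodule.mem_orthogonal]
    exact fun y hy => Submodule.mem_orthogonal_singleton_iff_inner_left.1 (hle hy)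
  refine iSup_le fun v y hy => Submodule.mem_orthogonal_singleton_iff_inner_left.2 ?_
  rw [Module.End.mem_eigenspace_iff] at hy
  replace hy : P (D (P y)) = v • y := hy
  by_cases hv : v = 0
  · have h1 := h (P y) 0 ⟪n, D (P y)⟫_ℝ (hPn y) (by
      rw [hv, zero_smul, hP, sub_eq_zero] at hy
      rw [zero_smul, zero_add]
      exact hy)
    rwa [hP, inner_sub_left, real_inner_smul_left, hx, mul_zero, sub_zero] at h1
  · have h2 : ⟪n, y⟫_ℝ = 0 := by
      have := hPn (D (P y))
      rw [hy, real_inner_smul_right] at this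
      exact (mul_eq_zero.1 this).resolve_left hv
    have h3 : P y = y := by rw [hP, h2, zero_smul, sub_zero]
    refine h y v ⟪n, D y⟫_ℝ h2 ?_
    rw [h3, hP] at hy
    rw [← hy, sub_add_cancel]

/-- If the matrix of a symmetric operator in a Hilbert basis is diagonal apart from the row and
column of index `j`, then the cubes of its diagonal entries can be summed in terms of traces. -/
lemma hasSum_cube_of_arrowhead {κ : Type*} [DecidableEq κ] (f : HilbertBasis κ ℝ E)
    {D : E →L[ℝ] E} (hs : ∀ x y, ⟪D x, y⟫_ℝ = ⟪x, D y⟫_ℝ) (j : κ) {v μ : κ → ℝ} (hj : v j = 0)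
    (hk : ∀ k ≠ j, D (f k) = v k • f k + μ k • f j) {τ : ℝ}
    (hτ : HasSum (fun k => ⟪f k, D (D (D (f k)))⟫_ℝ) τ) :
    HasSum (fun k => v k ^ 3) (τ - 3 * ⟪f j, D (D (D (f j)))⟫_ℝ
      + 3 * ⟪f j, D (f j)⟫_ℝ * ⟪f j, D (D (f j))⟫_ℝ - ⟪f j, D (f j)⟫_ℝ ^ 3) := by
  set δ := ⟪f j, D (f j)⟫_ℝ with hδ
  set β := ⟪f j, D (D (f j))⟫_ℝ with hβ
  set γ := ⟪f j, D (D (D (f j)))⟫_ℝ with hγ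
  have hunit : ∀ k, ⟪f k, f k⟫_ℝ = 1 := fun k => by
    rw [real_inner_self_eq_norm_sq, f.orthonormal.1 k, one_pow]
  have hne : ∀ k ≠ j, ⟪f k, f j⟫_ℝ = 0 := fun k h => f.orthonormal.2 h
  have hne' : ∀ k ≠ j, ⟪f j, f k⟫_ℝ = 0 := fun k h => f.orthonormal.2 h.symm
  have hμ : ∀ k ≠ j, ⟪f j, D (f k)⟫_ℝ = μ k := fun k h => by
    rw [hk k h, inner_add_right, real_inner_smul_right, real_inner_smul_right, hne' k h, hunit]
    ring
  have hμ' : ∀ k ≠ j, ⟪f k, D (f j)⟫_ℝ = μ k := fun k h => by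
    rw [← hμ k h, ← hs, real_inner_comm]
  have hγ' : ∀ k ≠ j, ⟪D (f j), D (f k)⟫_ℝ = v k * μ k + μ k * δ := fun k h => by
    rw [hk k h, inner_add_right, real_inner_smul_right, real_inner_smul_right, hs, hμ k h, hs]
  have hDD : ⟪D (f j), D (f j)⟫_ℝ = β := hs _ _
  -- Parseval for `‖D n‖²` and `⟪D n, D² n⟫`
  have h1 : HasSum (fun k => (if k = j then δ else μ k) ^ 2) β := by
    have := f.hasSum_inner_mul_inner (D (f j)) (D (f j))
    rw [hDD] at this
    refine this.congr_fun fun k => ?_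
    split_ifs with h
    · subst h; rw [real_inner_comm]; ring
    · rw [hμ' k h, real_inner_comm, hμ' k h]; ring
  have h2 : HasSum (fun k => v k * (if k = j then δ else μ k) ^ 2
      + δ * (if k = j then δ else μ k) ^ 2 + if k = j then δ * β - δ ^ 3 else 0) γ := by
    have := f.hasSum_inner_mul_inner (D (f j)) (D (D (f j)))
    rw [hs] at this
    refine this.congr_fun fun k => ?_
    split_ifs with h
    · subst h; rw [hj, real_inner_comm]; ring
    · rw [real_inner_comm, hμ' k h, ← hs, real_inner_comm, hγ' k h]; ring
  have h3 : HasSum (fun k => v k ^ 3 + 2 * (v k * (if k = j then δ else μ k) ^ 2)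
      + δ * (if k = j then δ else μ k) ^ 2 + if k = j then γ - δ ^ 3 else 0) τ := by
    refine hτ.congr_fun fun k => ?_
    split_ifs with h
    · subst h; rw [hj]; ring
    · rw [← hs, hk k h]
      simp only [map_add, map_smul, inner_add_left, inner_add_right, real_inner_smul_left,
        real_inner_smul_right, hμ' k h, hne k h, hne' k h, hunit, hk k h, ← hδ]
      ring
  have e1 := hasSum_ite_eq j (δ * β - δ ^ 3)
  have e2 := hasSum_ite_eq j (γ - δ ^ 3)
  have h4 := (h2.sub e1).sub (h1.mul_left δ)
  have h5 := ((h3.sub e2).sub (h1.mul_left δ)).sub (h4.mul_left 2)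
  convert! h5 using 1
  · funext k; ring
  · ring

end

lemma hasSum_mul_inner_lp {ι : Type*} (f g : lp (fun _ : ι => ℝ) 2) :
    HasSum (fun i => f i * g i) (inner ℝ f g) := by
  simpa [mul_comm] using lp.hasSum_inner (𝕜 := ℝ) f g

/-- The trace of the cube of a diagonal operator, computed in another Hilbert basis. -/
lemma hasSum_inner_cube_of_diagonal {ι κ : Type*} {a : ι → ℝ}
    {D : lp (fun _ : ι => ℝ) 2 →L[ℝ] lp (fun _ : ι => ℝ) 2} (hD : ∀ f i, D f i = a i * f i)
    (ha : Summable fun i => |a i ^ 3|) (f : HilbertBasis κ ℝ (lp (fun _ : ι => ℝ) 2)) :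
    HasSum (fun k => inner ℝ (f k) (D (D (D (f k))))) (∑' i, a i ^ 3) := by
  classical
  have h1 : ∀ k, HasSum (fun i => a i ^ 3 * f k i ^ 2) (inner ℝ (f k) (D (D (D (f k))))) := by
    intro k
    refine (hasSum_mul_inner_lp (f k) (D (D (D (f k))))).congr_fun fun i => ?_
    rw [hD, hD, hD]
    ring
  have h2 : ∀ i, HasSum (fun k => (f k i : ℝ) ^ 2) (1 : ℝ) := by
    intro i
    have h := f.hasSum_inner_mul_inner (lp.single 2 i (1 : ℝ)) (lp.single 2 i (1 : ℝ))
    simp only [lp.inner_single_left, lp.inner_single_right] at h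
    simpa [sq] using h
  have h3 : Summable fun p : ι × κ => a p.1 ^ 3 * f p.2 p.1 ^ 2 := by
    rw [← summable_abs_iff, summable_prod_of_nonneg (fun p => abs_nonneg _)]
    simp only [abs_mul, abs_pow, sq_abs]
    refine ⟨fun i => (h2 i).summable.mul_left _, ?_⟩
    refine ha.congr fun i => ?_
    rw [tsum_mul_left, (h2 i).tsum_eq, mul_one, abs_pow]
  have h4 := h3.hasSum
  have h5 := h4.prod_fiberwise (fun i => (h2 i).mul_left (a i ^ 3))
  simp only [mul_one] at h5
  rw [h5.tsum_eq]
  exact ((Equiv.prodComm κ ι).hasSum_iff.2 h4).prod_fiberwise h1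

lemma hasSum_option {α : Type*} {f : Option α → ℝ} {s : ℝ}
    (h : HasSum (fun m => f (some m)) s) : HasSum f (f none + s) := by
  classical
  have h1 : HasSum (fun i => if i = none then 0 else f i) s := by
    refine ((Option.some_injective α).hasSum_iff fun i hi => ?_).1 (h.congr_fun fun m => ?_)
    · rcases i with _ | m
      · simp
      · exact absurd ⟨m, rfl⟩ hi
    · simp
  refine ((hasSum_ite_eq none (f none)).add h1).congr_fun fun i => ?_
  rcases i with _ | m <;> simp

/-- The square summable family `(√A, ((x - m)⁻¹)ₘ)`. -/
noncomputable def cauchyVector (A x : ℝ) : lp (fun _ : Option ℤ => ℝ) 2 :=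
  ⟨fun i => i.elim √A fun m => (x - m)⁻¹, memℓp_gen (by
    refine (hasSum_option (Summable.hasSum ?_)).summable
    refine (summable_inv_sub_intCast_pow x le_rfl).congr fun m => ?_
    simp)⟩

@[simp] lemma cauchyVector_none (A x : ℝ) : cauchyVector A x none = √A := rfl

@[simp] lemma cauchyVector_some (A x : ℝ) (m : ℤ) : cauchyVector A x (some m) = (x - m)⁻¹ := rfl

lemma inner_eq_mul_add_of_hasSum {f g : lp (fun _ : Option ℤ => ℝ) 2} {s : ℝ}
    (h : HasSum (fun m : ℤ => f (some m) * g (some m)) s) :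
    inner ℝ f g = f none * g none + s :=
  (hasSum_mul_inner_lp f g).unique (hasSum_option (f := fun i => f i * g i) h)

lemma inner_cauchyVector {A x y : ℝ} (hA : 0 ≤ A) (hx : ∀ m : ℤ, x ≠ m) (hy : ∀ m : ℤ, y ≠ m)
    (hxy : x ≠ y) :
    inner ℝ (cauchyVector A x) (cauchyVector A y) =
      A + (π * cot (π * x) - π * cot (π * y)) / (y - x) := by
  rw [inner_eq_mul_add_of_hasSum (f := cauchyVector A x) (g := cauchyVector A y)
    (hasSum_inv_mul_inv_sub_intCast hx hy hxy), cauchyVector_none,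
    cauchyVector_none, Real.mul_self_sqrt hA]

lemma inner_cauchyVector_self {A x : ℝ} (hA : 0 ≤ A) (hx : ∀ m : ℤ, x ≠ m) :
    inner ℝ (cauchyVector A x) (cauchyVector A x) = A + π ^ 2 * (1 + cot (π * x) ^ 2) := by
  rw [inner_eq_mul_add_of_hasSum (s := π ^ 2 * (1 + cot (π * x) ^ 2)), cauchyVector_none,
    Real.mul_self_sqrt hA]
  rw [← tsum_inv_sub_intCast_sq hx]
  refine ((summable_inv_sub_intCast_pow x le_rfl).of_abs.hasSum).congr_fun fun m => ?_
  rw [cauchyVector_some, ← inv_pow, sq]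

/-- The coefficients of the diagonal operator having simple poles at the integers shifted by `x`. -/
noncomputable def cauchyWeight (x : ℝ) (i : Option ℤ) : ℝ := i.elim 0 fun m => (x - m)⁻¹

@[simp] lemma cauchyWeight_none (x : ℝ) : cauchyWeight x none = 0 := rfl

@[simp] lemma cauchyWeight_some (x : ℝ) (m : ℤ) : cauchyWeight x (some m) = (x - m)⁻¹ := rfl

lemma summable_abs_cauchyWeight_pow (x : ℝ) {r : ℕ} (hr : 2 ≤ r) :
    Summable fun i => |cauchyWeight x i ^ r| := by
  refine (hasSum_option (Summable.hasSum ?_)).summable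
  refine (summable_inv_sub_intCast_pow x hr).congr fun m => ?_
  simp

lemma tendsto_cauchyWeight (x : ℝ) : Tendsto (cauchyWeight x) cofinite (𝓝 0) := by
  have h := (Real.continuous_sqrt.tendsto 0).comp
    (summable_abs_cauchyWeight_pow x le_rfl).tendsto_cofinite_zero
  rw [Real.sqrt_zero] at h
  rw [tendsto_zero_iff_abs_tendsto_zero]
  refine h.congr fun i => ?_
  simp [Real.sqrt_sq_eq_abs]

lemma exists_cauchyDiagonal {x : ℝ} (hx : ∀ m : ℤ, x ≠ m) :
    ∃ D : lp (fun _ : Option ℤ => ℝ) 2 →L[ℝ] lp (fun _ : Option ℤ => ℝ) 2,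
      ∀ f i, D f i = cauchyWeight x i * f i := by
  obtain ⟨ε, hε, hm⟩ := exists_pos_le_abs_sub_intCast hx
  refine ⟨lp.mapCLM 2 (fun i => cauchyWeight x i • ContinuousLinearMap.id ℝ ℝ)
    (inv_nonneg.2 hε.le) ?_, fun f i => ?_⟩
  · intro i
    rw [norm_smul, ContinuousLinearMap.norm_id, mul_one, Real.norm_eq_abs]
    rcases i with _ | m
    · simpa using hε.le
    · rw [cauchyWeight_some, abs_inv]
      exact inv_anti₀ hε (hm m)
  · simp [lp.mapCLM_apply_coe]

lemma inner_diagonal_symm {ι : Type*} {a : ι → ℝ}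
    {D : lp (fun _ : ι => ℝ) 2 → lp (fun _ : ι => ℝ) 2} (hD : ∀ f i, D f i = a i * f i)
    (f g : lp (fun _ : ι => ℝ) 2) : inner ℝ (D f) g = inner ℝ f (D g) := by
  refine (hasSum_mul_inner_lp _ _).unique ((hasSum_mul_inner_lp _ _).congr_fun fun i => ?_)
  rw [hD, hD]
  ring

/-- If the compressed eigenvector equation holds then `y` is a multiple of a Cauchy vector. -/
lemma eq_zero_or_smul_cauchyVector {A x : ℝ} (hA : 0 < A) (hx : ∀ m : ℤ, x ≠ m)
    {D : lp (fun _ : Option ℤ => ℝ) 2 → lp (fun _ : Option ℤ => ℝ) 2}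
    (hD : ∀ f i, D f i = cauchyWeight x i * f i) {y : lp (fun _ : Option ℤ => ℝ) 2} {v μ : ℝ}
    (hy : inner ℝ (cauchyVector A x) y = 0) (hDy : D y = v • y + μ • cauchyVector A x) :
    y = 0 ∨ ∃ w s : ℝ, (∀ m : ℤ, w ≠ m) ∧ w ≠ x ∧
      inner ℝ (cauchyVector A x) (cauchyVector A w) = 0 ∧ y = s • cauchyVector A w := by
  have hA' : √A ≠ 0 := (Real.sqrt_pos.2 hA).ne'
  have hx' : ∀ m : ℤ, x - m ≠ 0 := fun m => sub_ne_zero.2 (hx m)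
  have hnone : v * y none + μ * √A = 0 := by
    have := hD y none
    rw [hDy, lp.coeFn_add] at this
    simpa using this
  have hsome : ∀ m : ℤ, v * y (some m) + μ * (x - m)⁻¹ = (x - m)⁻¹ * y (some m) := fun m => by
    have := hD y (some m)
    rw [hDy, lp.coeFn_add] at this
    simpa using this
  have hinner := hasSum_mul_inner_lp (cauchyVector A x) y
  rw [hy] at hinner
  by_cases hv : v = 0
  · left
    subst hv
    have hμ : μ = 0 := by simpa [hA'] using hnone
    have hym : ∀ m : ℤ, y (some m) = 0 := fun m => by
      have := hsome m
      rw [hμ] at this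
      simpa [hx' m] using this
    have h1 := hinner.unique (hasSum_option (s := 0) (by simp [hym]))
    ext i
    rcases i with _ | m
    · simpa [hA'] using h1.symm
    · exact hym m
  by_cases hμ : μ = 0
  · left
    subst hμ
    have hy0 : y none = 0 := by simpa [hv] using hnone
    have hym : ∀ m : ℤ, y (some m) ≠ 0 → (m : ℝ) = x - v⁻¹ := fun m hm => by
      have := hsome m
      rw [zero_mul, add_zero] at this
      rw [mul_right_cancel₀ hm this, inv_inv]
      ring
    by_contra hne
    have : ∃ m : ℤ, y (some m) ≠ 0 := by
      by_contra! h
      refine hne (lp.ext (funext fun i => ?_))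
      rcases i with _ | m
      · exact hy0
      · exact h m
    obtain ⟨m, hm⟩ := this
    have h1 := hinner.unique (hasSum_single (some m) fun i hi => ?_)
    · simp [hm, hx' m] at h1
    · rcases i with _ | l
      · simp [hy0]
      · by_cases hl : y (some l) = 0
        · simp [hl]
        · refine absurd ?_ hi
          have := (hym l hl).trans (hym m hm).symm
          rw [Int.cast_inj.1 this]
  · right
    have hw : ∀ m : ℤ, x - v⁻¹ - m ≠ 0 := fun m h => by
      have h1 : v = (x - m)⁻¹ := by
        rw [eq_comm, inv_eq_iff_eq_inv]
        linarith
      have := hsome m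
      rw [h1, add_eq_left] at this
      exact mul_ne_zero hμ (inv_ne_zero (hx' m)) this
    have hyw : y = (-μ / v) • cauchyVector A (x - v⁻¹) := by
      ext i
      rcases i with _ | m
      · simp only [lp.coeFn_smul, Pi.smul_apply, cauchyVector_none, smul_eq_mul]
        field_simp
        linarith
      · simp only [lp.coeFn_smul, Pi.smul_apply, cauchyVector_some, smul_eq_mul]
        have h1 := hsome m
        have h2 := hw m
        have h3 := hx' m
        have h4 : v * (x - m) - 1 ≠ 0 := fun h => h2 (by
          field_simp
          linarith)
        field_simp at h1
        have h5 : -μ / v * (x - v⁻¹ - m)⁻¹ = -μ / (v * (x - m) - 1) := by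
          have : x - v⁻¹ - m = (v * (x - m) - 1) / v := by field_simp; ring
          rw [this]
          field_simp
        rw [h5, eq_div_iff h4]
        linarith
    have hs : -μ / v ≠ 0 := div_ne_zero (neg_ne_zero.2 hμ) hv
    refine ⟨x - v⁻¹, -μ / v, fun m => sub_ne_zero.1 (hw m), ?_, ?_, hyw⟩
    · simpa using hv
    · rw [hyw, real_inner_smul_right] at hy
      exact (mul_eq_zero.1 hy).resolve_left hs

/-- If `Z` enumerates the roots of `A (w + b) = π cot (π w)`, the sum of `(Z j - Z k)⁻³` is
explicit. -/
lemma hasSum_inv_sub_cube_of_roots {κ : Type*} [DecidableEq κ] {A b : ℝ} (hA : 0 < A) {Z : κ → ℝ}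
    (hinj : Function.Injective Z) (hZ : ∀ k, ∀ m : ℤ, Z k ≠ m)
    (hroot : ∀ k, A * (Z k + b) = π * cot (π * Z k))
    (hall : ∀ w : ℝ, (∀ m : ℤ, w ≠ m) → A * (w + b) = π * cot (π * w) → ∃ k, Z k = w) (j : κ) :
    HasSum (fun k => ((Z j - Z k)⁻¹) ^ 3)
      (π ^ 3 * cot (π * Z j) * (1 + cot (π * Z j) ^ 2) * A ^ 2 * (A + π ^ 2) /
        (A + π ^ 2 * (1 + cot (π * Z j) ^ 2)) ^ 3) := by
  obtain ⟨D, hD⟩ := exists_cauchyDiagonal (hZ j)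
  have hs : ∀ f g, inner ℝ (D f) g = inner ℝ f (D g) := inner_diagonal_symm hD
  let B : κ → ℝ := fun k => A + π ^ 2 * (1 + cot (π * Z k) ^ 2)
  have hB : ∀ k, 0 < B k := fun k => by positivity
  have hBs : ∀ k, √(B k) ≠ 0 := fun k => (Real.sqrt_pos.2 (hB k)).ne'
  have hself : ∀ k, inner ℝ (cauchyVector A (Z k)) (cauchyVector A (Z k)) = B k :=
    fun k => inner_cauchyVector_self hA.le (hZ k)
  have horth : ∀ k l, k ≠ l → inner ℝ (cauchyVector A (Z k)) (cauchyVector A (Z l)) = 0 := by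
    intro k l hkl
    have h := hinj.ne hkl
    have h' : Z l - Z k ≠ 0 := sub_ne_zero.2 h.symm
    rw [inner_cauchyVector hA.le (hZ k) (hZ l) h, ← hroot, ← hroot]
    field_simp
    ring
  let F : κ → lp (fun _ : Option ℤ => ℝ) 2 := fun k => (√(B k))⁻¹ • cauchyVector A (Z k)
  have hFn : ∀ k, inner ℝ (F k) (F k) = (1 : ℝ) := fun k => by
    rw [real_inner_smul_left, real_inner_smul_right, hself, ← mul_assoc, ← mul_inv,
      Real.mul_self_sqrt (hB k).le, inv_mul_cancel₀ (hB k).ne']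
  have hFo : Orthonormal ℝ F := by
    refine ⟨fun k => ?_, fun k l hkl => ?_⟩
    · have := hFn k
      rw [real_inner_self_eq_norm_sq] at this
      exact (pow_eq_one_iff_of_nonneg (norm_nonneg _) two_ne_zero).1 this
    · change inner ℝ (F k) (F l) = (0 : ℝ)
      rw [real_inner_smul_left, real_inner_smul_right, horth k l hkl, mul_zero, mul_zero]
  have hsp : (Submodule.span ℝ (Set.range F))ᗮ = ⊥ := by
    rw [eq_bot_iff]
    intro x hx
    have hx' : ∀ k, inner ℝ (F k) x = (0 : ℝ) := fun k =>
      (Submodule.mem_orthogonal _ _).1 hx _ (Submodule.subset_span ⟨k, rfl⟩)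
    have hxk : ∀ k, inner ℝ (cauchyVector A (Z k)) x = (0 : ℝ) := fun k => by
      have := hx' k
      rw [real_inner_smul_left] at this
      exact (mul_eq_zero.1 this).resolve_left (inv_ne_zero (hBs k))
    refine (Submodule.mem_bot ℝ).2 (eq_zero_of_inner_compression_eigenvectors_eq_zero
      (isCompactOperator_of_diagonal (tendsto_cauchyWeight _) D hD) hs (hFn j) (hx' j) ?_)
    intro y v μ hy hDy
    have hy' : inner ℝ (cauchyVector A (Z j)) y = 0 := by
      rw [real_inner_smul_left] at hy
      exact (mul_eq_zero.1 hy).resolve_left (inv_ne_zero (hBs j))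
    rw [smul_smul] at hDy
    obtain rfl | ⟨w, s, hw, hwx, hwi, rfl⟩ := eq_zero_or_smul_cauchyVector hA (hZ j) hD hy' hDy
    · exact inner_zero_left _
    · obtain ⟨k, rfl⟩ := hall w hw (by
        have h0 : w - Z j ≠ 0 := sub_ne_zero.2 hwx
        rw [inner_cauchyVector hA.le (hZ j) hw hwx.symm, ← hroot] at hwi
        field_simp at hwi
        linarith)
      rw [real_inner_smul_left, hxk, mul_zero]
  let f := HilbertBasis.mkOfOrthogonalEqBot hFo hsp
  have hf : ∀ k, f k = F k := fun k => by rw [HilbertBasis.coe_mkOfOrthogonalEqBot]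
  have hk : ∀ k ≠ j, D (f k) = (Z j - Z k)⁻¹ • f k +
      (-((√(B k))⁻¹ * (Z j - Z k)⁻¹ * √(B j))) • f j := by
    intro k hkj
    have h : Z j - Z k ≠ 0 := sub_ne_zero.2 (hinj.ne hkj.symm)
    have h1 : D (cauchyVector A (Z k)) =
        (Z j - Z k)⁻¹ • cauchyVector A (Z k) - (Z j - Z k)⁻¹ • cauchyVector A (Z j) := by
      ext i
      rw [hD]
      rw [lp.coeFn_sub]
      rcases i with _ | m
      · simp
      · have h2 := sub_ne_zero.2 (hZ j m)
        have h3 := sub_ne_zero.2 (hZ k m)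
        simp only [cauchyWeight_some, cauchyVector_some, lp.coeFn_smul, Pi.sub_apply,
          Pi.smul_apply, smul_eq_mul]
        field_simp
        ring
    rw [hf, hf]
    simp only [F, map_smul, h1, smul_sub, smul_smul]
    rw [neg_mul, mul_assoc _ √(B j), mul_inv_cancel₀ (hBs j), mul_one, mul_comm (Z j - Z k)⁻¹,
      neg_smul, sub_eq_add_neg]
  have hτ := hasSum_inner_cube_of_diagonal hD (summable_abs_cauchyWeight_pow (Z j) (by norm_num)) f
  have hsum := hasSum_cube_of_arrowhead f hs j (v := fun k => (Z j - Z k)⁻¹) (by simp) hk hτ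
  have hw : ∀ r, 2 ≤ r → Summable fun m : ℤ => ((Z j - m) ^ r)⁻¹ := fun r hr =>
    (summable_inv_sub_intCast_pow (Z j) hr).of_abs
  have htr : ∑' i, cauchyWeight (Z j) i ^ 3 =
      π ^ 3 * (cot (π * Z j) * (1 + cot (π * Z j) ^ 2)) := by
    rw [← tsum_inv_sub_intCast_cube (hZ j)]
    refine HasSum.tsum_eq ?_
    convert! hasSum_option (f := fun i => cauchyWeight (Z j) i ^ 3)
      (s := ∑' m : ℤ, ((Z j - m) ^ 3)⁻¹) ?_ using 1
    · simp
    · simpa using (hw 3 (by norm_num)).hasSum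
  have hmom : ∀ (T : lp (fun _ : Option ℤ => ℝ) 2) (g : lp (fun _ : Option ℤ => ℝ) 2) (r : ℕ),
      2 ≤ r → T = (√(B j))⁻¹ • g → g none = 0 →
      (∀ m : ℤ, g (some m) = ((Z j - m) ^ (r - 1))⁻¹) →
      inner ℝ (f j) T = (∑' m : ℤ, ((Z j - m) ^ r)⁻¹) / B j := by
    rintro T g r hr rfl hg0 hgm
    rw [hf, real_inner_smul_left, real_inner_smul_right, inner_eq_mul_add_of_hasSum
      (s := ∑' m : ℤ, ((Z j - m) ^ r)⁻¹), hg0, mul_zero, zero_add, ← mul_assoc, ← mul_inv,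
      Real.mul_self_sqrt (hB j).le, div_eq_inv_mul]
    refine (hw r hr).hasSum.congr_fun fun m => ?_
    rw [hgm, cauchyVector_some, ← mul_inv, ← pow_succ']
    congr 3
    omega
  have m3 := hmom (D (f j)) (D (cauchyVector A (Z j))) 3 (by norm_num) (by simp [hf, F])
    (by simp [hD]) (fun m => by simp [hD, sq])
  have m4 := hmom (D (D (f j))) (D (D (cauchyVector A (Z j)))) 4 (by norm_num) (by simp [hf, F])
    (by simp [hD]) (fun m => by simp [hD, pow_succ, mul_assoc])
  have m5 := hmom (D (D (D (f j)))) (D (D (D (cauchyVector A (Z j))))) 5 (by norm_num)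
    (by simp [hf, F]) (by simp [hD]) (fun m => by simp [hD, pow_succ, mul_assoc])
  rw [htr, m3, m4, m5, tsum_inv_sub_intCast_cube (hZ j), tsum_inv_sub_intCast_pow_four (hZ j),
    tsum_inv_sub_intCast_pow_five (hZ j)] at hsum
  convert! hsum using 1
  have hBj : A + π ^ 2 * (1 + cot (π * Z j) ^ 2) ≠ 0 := (hB j).ne'
  simp only [B]
  generalize cot (π * Z j) = C at *
  field_simp
  ring

/-- The inverse of `y ↦ arctan y / π + (π / A) y`. -/
lemma exists_orderIso_arctan_add {A : ℝ} (hA : 0 < A) :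
    ∃ Y : ℝ ≃o ℝ, ∀ y, Y (arctan y / π + π / A * y) = y := by
  have hm : StrictMono fun y : ℝ => arctan y / π + π / A * y := by
    intro x y hxy
    have h1 : arctan x < arctan y := arctan_strictMono hxy
    have h2 := pi_pos
    simp only
    gcongr
  have hlin : 0 < π / A := div_pos pi_pos hA
  have hs : Function.Surjective fun y : ℝ => arctan y / π + π / A * y := by
    refine Continuous.surjective (by fun_prop) ?_ ?_
    · refine tendsto_atTop_add_left_of_le _ (-(π / 2) / π) (fun y => ?_)
        (tendsto_id.const_mul_atTop hlin)
      have := neg_pi_div_two_lt_arctan y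
      have := pi_pos
      gcongr
    · refine tendsto_atBot_add_left_of_ge _ (π / 2 / π) (fun y => ?_)
        (tendsto_id.const_mul_atBot hlin)
      have := arctan_lt_pi_div_two y
      have := pi_pos
      gcongr
  exact ⟨(hm.orderIsoOfSurjective _ hs).symm, fun y =>
    (hm.orderIsoOfSurjective _ hs).symm_apply_apply y⟩

lemma cot_eq_tan_pi_div_two_sub (x : ℝ) : cot x = tan (π / 2 - x) := by
  rw [Real.cot_eq_cos_div_sin, Real.tan_eq_sin_div_cos, Real.sin_pi_div_two_sub,
    Real.cos_pi_div_two_sub]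

lemma exists_arctan_cot_eq {x : ℝ} (hx : sin x ≠ 0) :
    ∃ n : ℤ, arctan (cot x) = π / 2 - x + n * π := by
  have h : sin (arctan (cot x) - (π / 2 - x)) = 0 := by
    have h1 : sin (arctan (cot x)) = cos x / sin x * cos (arctan (cot x)) := by
      have h2 := Real.tan_arctan (cot x)
      rw [Real.tan_eq_sin_div_cos, div_eq_iff (cos_arctan_pos _).ne'] at h2
      rwa [← Real.cot_eq_cos_div_sin]
    rw [Real.sin_sub, Real.sin_pi_div_two_sub, Real.cos_pi_div_two_sub, h1]
    field_simp
    ring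
  obtain ⟨n, hn⟩ := Real.sin_eq_zero_iff.1 h
  exact ⟨n, by linarith⟩

section

variable {A : ℝ} {Y : ℝ ≃o ℝ}

lemma arctan_add_eq_of_leftInverse (hY : ∀ y, Y (arctan y / π + π / A * y) = y) (s : ℝ) :
    arctan (Y s) / π + π / A * Y s = s :=
  Y.injective (hY (Y s))

lemma hasDerivAt_of_leftInverse_arctan_add (hA : 0 < A)
    (hY : ∀ y, Y (arctan y / π + π / A * y) = y) (s : ℝ) :
    HasDerivAt Y (A * π * (1 + Y s ^ 2) / (A + π ^ 2 * (1 + Y s ^ 2))) s := by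
  have h1 : HasDerivAt (fun y : ℝ => arctan y / π + π / A * y)
      (1 / (1 + Y s ^ 2) / π + π / A * 1) (Y s) :=
    ((hasDerivAt_arctan _).div_const π).add ((hasDerivAt_id' _).const_mul (π / A))
  have hpos : 0 < 1 / (1 + Y s ^ 2) / π + π / A * 1 := by positivity
  have h2 := h1.of_local_left_inverse Y.continuous.continuousAt hpos.ne'
    (Eventually.of_forall (arctan_add_eq_of_leftInverse hY))
  convert! h2 using 1
  have h3 : 0 < 1 + Y s ^ 2 := by positivity
  have h4 : 0 < A + π ^ 2 * (1 + Y s ^ 2) := by positivity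
  have := pi_pos
  field_simp

lemma hasDerivAt_arctan_div_pi (hA : 0 < A)
    (hY : ∀ y, Y (arctan y / π + π / A * y) = y) (s : ℝ) :
    HasDerivAt (fun s => arctan (Y s) / π) (A / (A + π ^ 2 * (1 + Y s ^ 2))) s := by
  have h1 := (hasDerivAt_of_leftInverse_arctan_add hA hY s).arctan.div_const π
  convert! h1 using 1
  have h3 : 0 < 1 + Y s ^ 2 := by positivity
  have h4 : 0 < A + π ^ 2 * (1 + Y s ^ 2) := by positivity
  have := pi_pos
  field_simp

lemma hasDerivAt_div_add_sq (hA : 0 < A)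
    (hY : ∀ y, Y (arctan y / π + π / A * y) = y) (s : ℝ) :
    HasDerivAt (fun s => A / (A + π ^ 2 * (1 + Y s ^ 2)))
      (-(2 * π ^ 3 * A ^ 2 * Y s * (1 + Y s ^ 2) / (A + π ^ 2 * (1 + Y s ^ 2)) ^ 3)) s := by
  have h4 : 0 < A + π ^ 2 * (1 + Y s ^ 2) := by positivity
  have h1 := (hasDerivAt_const s A).fun_div (((((hasDerivAt_of_leftInverse_arctan_add hA hY
    s).fun_pow 2).const_add 1).const_mul (π ^ 2)).const_add A) h4.ne'
  convert! h1 using 1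
  field_simp
  ring

lemma hasSum_inv_sub_cube_of_leftInverse (hA : 0 < A)
    (hY : ∀ y, Y (arctan y / π + π / A * y) = y) (r : ℝ) (j : ℤ) :
    HasSum (fun k : ℤ =>
        (((j - arctan (Y (j - r)) / π) - (k - arctan (Y (k - r)) / π))⁻¹) ^ 3)
      (π ^ 3 * Y (j - r) * (1 + Y (j - r) ^ 2) * A ^ 2 * (A + π ^ 2) /
        (A + π ^ 2 * (1 + Y (j - r) ^ 2)) ^ 3) := by
  have hG := arctan_add_eq_of_leftInverse hY
  let Z : ℤ → ℝ := fun k => k - arctan (Y (k - r)) / π - 1 / 2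
  have hZr : ∀ k : ℤ, Z k + (1 / 2 - r) = π / A * Y (k - r) := fun k => by
    have := hG (k - r)
    simp only [Z]
    linarith
  have hcot : ∀ k : ℤ, cot (π * Z k) = Y (k - r) := fun k => by
    have h1 : π / 2 - π * Z k = arctan (Y (k - r)) + ((1 - k : ℤ) : ℝ) * π := by
      simp only [Z]
      push_cast
      field_simp
      ring
    rw [cot_eq_tan_pi_div_two_sub, h1, Real.tan_add_int_mul_pi, Real.tan_arctan]
  have hZint : ∀ k, ∀ m : ℤ, Z k ≠ m := by
    intro k m h
    have h1 : arctan (Y (k - r)) = π * ((k - m : ℤ) - 1 / 2) := by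
      simp only [Z] at h
      field_simp at h
      push_cast
      linarith
    have h2 := neg_pi_div_two_lt_arctan (Y (k - r))
    have h3 := arctan_lt_pi_div_two (Y (k - r))
    rw [h1] at h2 h3
    have h4 : (0 : ℝ) < (k - m : ℤ) := by nlinarith [pi_pos]
    have h5 : ((k - m : ℤ) : ℝ) < 1 := by nlinarith [pi_pos]
    have h6 : 0 < k - m := by exact_mod_cast h4
    have h7 : k - m < 1 := by exact_mod_cast h5
    omega
  have hinj : Function.Injective Z := fun k l h => by
    have h1 : π / A * Y (k - r) = π / A * Y (l - r) := by rw [← hZr, ← hZr, h]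
    have h2 := Y.injective (mul_left_cancel₀ (div_pos pi_pos hA).ne' h1)
    exact_mod_cast sub_left_injective h2
  have hroot : ∀ k, A * (Z k + (1 / 2 - r)) = π * cot (π * Z k) := fun k => by
    rw [hZr, hcot]
    field_simp
  have hall : ∀ w : ℝ, (∀ m : ℤ, w ≠ m) → A * (w + (1 / 2 - r)) = π * cot (π * w) →
      ∃ k, Z k = w := by
    intro w hw h
    obtain ⟨n, hn⟩ := exists_arctan_cot_eq (sin_pi_mul_ne_zero_of_ne_intCast hw)
    have hw' : w + (1 / 2 - r) = π / A * cot (π * w) := by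
      rw [div_mul_eq_mul_div, eq_div_iff hA.ne', mul_comm, h]
    refine ⟨n + 1, add_right_cancel ((hZr (n + 1)).trans ?_)⟩
    rw [hw', ← hY (cot (π * w)), hn, ← hw']
    congr 2
    push_cast
    field_simp
    ring
  have h := hasSum_inv_sub_cube_of_roots hA hinj hZint hroot hall j
  rw [hcot] at h
  refine h.congr_fun fun k => ?_
  simp only [Z]
  ring

end

/-- **Solitary waves for the infinite Calogero-Moser lattice.**
For each wave speed `c` with `c² > π²` there is a strictly increasing profile
`φ : ℝ → ℝ` increasing from `-1/2` to `1/2`, satisfying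
`(c² − π²)(s − φ(s)) = π tan(π φ(s))`, such that `x_j(t) = j − φ(j − c t)` is a
solitary-wave solution of the infinite Calogero-Moser lattice. -/
theorem solitary_wave_CM (c : ℝ) (hc : c ^ 2 > π ^ 2) :
    ∃ φ : ℝ → ℝ, StrictMono φ ∧
      Tendsto φ atBot (𝓝 (-(1 / 2))) ∧
      Tendsto φ atTop (𝓝 (1 / 2)) ∧
      (∀ s : ℝ, (c ^ 2 - π ^ 2) * (s - φ s) = π * Real.tan (π * φ s)) ∧
      ∃ x' x'' : ℤ → ℝ → ℝ,
        ∀ (j : ℤ) (t : ℝ),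
          HasDerivAt (fun t' : ℝ => (j : ℝ) - φ ((j : ℝ) - c * t')) (x' j t) t ∧
          HasDerivAt (x' j) (x'' j t) t ∧
          Summable (fun k : {k : ℤ // k ≠ j} =>
            2 / (((j : ℝ) - φ ((j : ℝ) - c * t))
              - (((k : ℤ) : ℝ) - φ (((k : ℤ) : ℝ) - c * t))) ^ 3) ∧
          x'' j t = ∑' k : {k : ℤ // k ≠ j},
            2 / (((j : ℝ) - φ ((j : ℝ) - c * t))
              - (((k : ℤ) : ℝ) - φ (((k : ℤ) : ℝ) - c * t))) ^ 3 := by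
  obtain ⟨A, hAc⟩ : ∃ A, A = c ^ 2 - π ^ 2 := ⟨_, rfl⟩
  have hA : 0 < A := by linarith
  obtain ⟨Y, hY⟩ := exists_orderIso_arctan_add hA
  have hG := arctan_add_eq_of_leftInverse hY
  have hπ := pi_pos
  refine ⟨fun s => arctan (Y s) / π, ?_, ?_, ?_, ?_, ?_⟩
  · intro x y hxy
    have h := arctan_strictMono (Y.strictMono hxy)
    simp only
    gcongr
  · have h := ((tendsto_nhds_of_tendsto_nhdsWithin tendsto_arctan_atBot).comp
      Y.tendsto_atBot).div_const π
    convert! h using 2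
    field_simp
  · have h := ((tendsto_nhds_of_tendsto_nhdsWithin tendsto_arctan_atTop).comp
      Y.tendsto_atTop).div_const π
    convert! h using 2
    field_simp
  · intro s
    have h : s - arctan (Y s) / π = π / A * Y s := by linarith [hG s]
    rw [← hAc, h, mul_div_cancel₀ _ hπ.ne', Real.tan_arctan]
    field_simp
  refine ⟨fun j t => -(A / (A + π ^ 2 * (1 + Y (j - c * t) ^ 2)) * -c),
    fun j t => -(-(2 * π ^ 3 * A ^ 2 * Y (j - c * t) * (1 + Y (j - c * t) ^ 2) /
      (A + π ^ 2 * (1 + Y (j - c * t) ^ 2)) ^ 3) * -c * -c), fun j t => ?_⟩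
  have hlin : HasDerivAt (fun t : ℝ => (j : ℝ) - c * t) (-c) t := by
    simpa using ((hasDerivAt_id' t).const_mul c).const_sub (j : ℝ)
  have hsum : HasSum (fun k : {k : ℤ // k ≠ j} =>
      2 / (((j : ℝ) - arctan (Y ((j : ℝ) - c * t)) / π)
        - (((k : ℤ) : ℝ) - arctan (Y (((k : ℤ) : ℝ) - c * t)) / π)) ^ 3)
      (-(-(2 * π ^ 3 * A ^ 2 * Y (j - c * t) * (1 + Y (j - c * t) ^ 2) /
      (A + π ^ 2 * (1 + Y (j - c * t) ^ 2)) ^ 3) * -c * -c)) := by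
    have h := (hasSum_inv_sub_cube_of_leftInverse hA hY (c * t) j).mul_left 2
    rw [← hasSum_subtype_iff_of_support_subset (s := {k | k ≠ j})
      (fun k hk hkj => hk (by simp [hkj]))] at h
    have hval : A + π ^ 2 = c ^ 2 := by linarith
    rw [hval] at h
    convert! h using 1
    · funext k
      simp only [Function.comp_apply]
      rw [inv_pow, div_eq_mul_inv]
    · ring
  exact ⟨((hasDerivAt_arctan_div_pi hA hY _).comp t hlin).const_sub _,
    (((hasDerivAt_div_add_sq hA hY _).comp t hlin).mul_const (-c)).neg,
    hsum.summable, hsum.tsum_eq.symm⟩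
end

section
/- Let N ≥ 2 be an integer, L = N − 1, a = π/L, and let c > π + a. Set ν = sqrt((c² − (π+a)²)/(c² − (π−a)²)) and κ = (1+ν)/(1−ν). Then there exists an odd, strictly increasing function φ: ℝ → ℝ with φ(s+N) = φ(s) + 1 for all s, satisfying κ·tan(a(s − φ(s))) = tan(π·φ(s)) for all s ∈ (−N/2, N/2), such that the positions x_j(t) := j − φ(j − c t), j ∈ ℤ, form a periodic traveling-wave solution of the infinite Calogero-Moser lattice: x_{j+N}(t) = x_j(t) + L for all j and t, each t ↦ x_j(t) is twice differentiable, the series Σ_{k∈ℤ, k≠j} 2/(x_j(t) − x_k(t))³ converges absolutely, and ẍ_j(t) = Σ_{k∈ℤ, k≠j} 2/(x_j(t) − x_k(t))³ for all j ∈ ℤ and t ∈ ℝ. -/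
open Real Filter Topology

/-- Two functions agreeing on an open set have equal derivatives there. -/
lemma eqOn_of_hasDerivAt {f g f' g' : ℝ → ℝ} {s : Set ℝ} (hs : IsOpen s) (h : Set.EqOn f g s)
    (hf : ∀ x ∈ s, HasDerivAt f (f' x) x) (hg : ∀ x ∈ s, HasDerivAt g (g' x) x) :
    Set.EqOn f' g' s := fun x hx =>
  (hf x hx).unique ((hg x hx).congr_of_eventuallyEq (h.eventuallyEq_of_mem (hs.mem_nhds hx)))

/-- The partial fraction expansion of the cotangent on the unit interval. -/
lemma pi_mul_cot_hasSum {x : ℝ} (hx : x ∈ Set.Ioo (0 : ℝ) 1) :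
    HasSum (fun n : ℕ => (1 / (x - (n + 1)) + 1 / (x + (n + 1))))
      (π * (cos (π * x) / sin (π * x)) - 1 / x) := by
  have hmem : (x : ℂ) ∈ Complex.integerComplement := by
    rw [Complex.mem_integerComplement_iff]
    rintro ⟨n, hn⟩
    have : (n : ℝ) = x := by exact_mod_cast hn
    rw [← this] at hx
    have h0 : (0 : ℤ) < n := by exact_mod_cast hx.1
    have h1 : n < (1 : ℤ) := by exact_mod_cast hx.2
    omega
  have h := (summable_cotTerm hmem).hasSum
  unfold cotTerm at h
  rw [← cot_series_rep' hmem, Complex.cot] at h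
  exact_mod_cast h

lemma hasDerivAt_one_div_add_pow {x d : ℝ} (hx : x + d ≠ 0) (p : ℕ) :
    HasDerivAt (fun z => 1 / (z + d) ^ p) (-p / (x + d) ^ (p + 1)) x := by
  convert! (hasDerivAt_const x (1 : ℝ)).div (((hasDerivAt_id x).add_const d).fun_pow p)
    (pow_ne_zero p hx) using 1
  rcases p with _ | p
  · simp
  · simp only [id, Nat.add_sub_cancel]
    field_simp
    push_cast
    ring

lemma hasDerivAt_cot {x : ℝ} (hx : sin x ≠ 0) :
    HasDerivAt (fun y => cos y / sin y) (-1 / sin x ^ 2) x := by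
  convert! (hasDerivAt_cos x).div (hasDerivAt_sin x) hx using 1
  field_simp
  linarith [sin_sq_add_cos_sq x]

lemma hasDerivAt_neg_one_div_sin_sq {x : ℝ} (hx : sin x ≠ 0) :
    HasDerivAt (fun y => -1 / sin y ^ 2) (2 * cos x / sin x ^ 3) x := by
  convert! (hasDerivAt_const x (-1 : ℝ)).div ((hasDerivAt_sin x).fun_pow 2) (pow_ne_zero 2 hx) using 1
  field_simp
  push_cast
  ring

lemma differentiableAt_two_mul_cos_div_sin_cube {x : ℝ} (hx : sin x ≠ 0) :
    DifferentiableAt ℝ (fun y => 2 * cos y / sin y ^ 3) x := by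
  fun_prop (disch := exact pow_ne_zero 3 hx)

/-- Termwise differentiation of a series over the unit interval whose terms have derivatives
bounded by inverse powers of the distance to the nearest nonzero integers. -/
lemma hasDerivAt_tsum_of_bound_Ioo {g g' : ℕ → ℝ → ℝ} {C : ℝ} {p : ℕ} (hp : 2 ≤ p)
    (hg : ∀ n, ∀ y ∈ Set.Ioo (0 : ℝ) 1, HasDerivAt (g n) (g' n y) y)
    (hg' : ∀ n, ∀ y ∈ Set.Ioo (0 : ℝ) 1, |g' n y| ≤ C / (n + 1 - y) ^ p)
    (hs : ∀ y ∈ Set.Ioo (0 : ℝ) 1, Summable fun n => g n y) {x : ℝ}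
    (hx : x ∈ Set.Ioo (0 : ℝ) 1) :
    HasDerivAt (fun z => ∑' n, g n z) (∑' n, g' n x) x := by
  obtain ⟨b, hxb, hb⟩ := exists_between hx.2
  have hsub : Set.Ioo 0 b ⊆ Set.Ioo (0 : ℝ) 1 := fun y hy => ⟨hy.1, hy.2.trans hb⟩
  have hC : 0 ≤ C := by
    have h := (abs_nonneg _).trans (hg' 0 x hx)
    have h1 : 0 < ((0 : ℕ) + 1 - x) ^ p := by
      apply pow_pos; simpa using hx.2
    by_contra! hneg
    linarith [div_neg_of_neg_of_pos hneg h1]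
  have hu : Summable fun n : ℕ => C / (1 - b) ^ p * (1 / ((n : ℝ) + 1) ^ p) := by
    apply Summable.mul_left
    have := (summable_nat_add_iff 1).2 (Real.summable_one_div_nat_pow.2 (by omega : 1 < p))
    simpa using this
  refine hasDerivAt_tsum_of_isPreconnected (t := Set.Ioo 0 b) hu isOpen_Ioo isPreconnected_Ioo
    (fun n y hy => hg n y (hsub hy)) (fun n y hy => ?_) ⟨hx.1, hxb⟩ (hs x hx) ⟨hx.1, hxb⟩
  refine (hg' n y (hsub hy)).trans ?_
  rw [div_mul_div_comm, mul_one, ← mul_pow]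
  have h1 : 0 < (1 - b) * ((n : ℝ) + 1) := mul_pos (by linarith) (by positivity)
  have h2 : (1 - b) * ((n : ℝ) + 1) ≤ n + 1 - y := by
    have : b * 1 ≤ b * ((n : ℝ) + 1) :=
      mul_le_mul_of_nonneg_left (by linarith [n.cast_nonneg (α := ℝ)]) (hy.1.trans hy.2).le
    linarith [hy.2]
  gcongr

lemma summable_one_div_add_intCast_pow (x : ℝ) {p : ℕ} (hp : 2 ≤ p) :
    Summable fun m : ℤ => 1 / (x + m) ^ p := by
  have h := (Real.summable_one_div_int_add_rpow x p).2 (by exact_mod_cast hp)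
  refine Summable.of_norm (h.congr fun m => ?_)
  rw [rpow_natCast, norm_div, norm_pow, norm_one, Real.norm_eq_abs, add_comm]

/-- Summation over the integers of `1 / (x + m) ^ p`, with opposite integers paired. -/
lemma tsum_one_div_add_intCast_pow (x : ℝ) {p : ℕ} (hp : 2 ≤ p) :
    (Summable fun n : ℕ => (1 / (x - (n + 1)) ^ p + 1 / (x + (n + 1)) ^ p)) ∧
    ∑' m : ℤ, 1 / (x + m) ^ p =
      1 / x ^ p + ∑' n : ℕ, (1 / (x - (n + 1)) ^ p + 1 / (x + (n + 1)) ^ p) := by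
  have h := summable_one_div_add_intCast_pow x hp
  have h1 : Summable fun n : ℕ => 1 / (x + n) ^ p := by
    exact (h.comp_injective (Nat.cast_injective (R := ℤ))).congr fun n => by simp
  have h2 : Summable fun n : ℕ => 1 / (x + (n + 1)) ^ p := by
    simpa using (summable_nat_add_iff 1).2 h1
  have h3 : Summable fun n : ℕ => 1 / (x - (n + 1)) ^ p := by
    have := h.comp_injective (i := fun n : ℕ => -((n : ℤ) + 1)) (fun a b hab => by simpa using hab)
    refine this.congr fun n => ?_
    simp [sub_eq_add_neg]
  refine ⟨h3.add h2, ?_⟩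
  rw [tsum_of_nat_of_neg_add_one (f := fun m : ℤ => 1 / (x + m) ^ p) (by simpa using h1)
    (by refine h3.congr fun n => ?_
        simp [sub_eq_add_neg])]
  rw [h3.tsum_add h2]
  simp only [Int.cast_natCast, h1.tsum_eq_zero_add]
  simp [sub_eq_add_neg]
  ring

/-- The second derivative of the partial fraction expansion of the cotangent. -/
lemma hasSum_two_div_add_intCast_cube {x : ℝ} (hx : x ∈ Set.Ioo (0 : ℝ) 1) :
    HasSum (fun m : ℤ => 2 / (x + m) ^ 3) (π ^ 3 * (2 * cos (π * x) / sin (π * x) ^ 3)) := by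
  have hsin : ∀ y ∈ Set.Ioo (0 : ℝ) 1, sin (π * y) ≠ 0 := fun y hy =>
    (sin_pos_of_pos_of_lt_pi (mul_pos pi_pos hy.1) (by nlinarith [pi_pos, hy.2])).ne'
  have hpi : ∀ y : ℝ, HasDerivAt (fun z => π * z) π y := fun y => by
    simpa using (hasDerivAt_id y).const_mul π
  have hneg : ∀ n : ℕ, ∀ y ∈ Set.Ioo (0 : ℝ) 1, y - (n + 1) ≠ 0 := fun n y hy => by
    linarith [hy.2, n.cast_nonneg (α := ℝ)]
  have hpos : ∀ n : ℕ, ∀ y ∈ Set.Ioo (0 : ℝ) 1, y + (n + 1) ≠ 0 := fun n y hy => by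
    linarith [hy.1, n.cast_nonneg (α := ℝ)]
  have hder : ∀ (p n : ℕ), ∀ y ∈ Set.Ioo (0 : ℝ) 1,
      HasDerivAt (fun z : ℝ => 1 / (z - (n + 1)) ^ p + 1 / (z + (n + 1)) ^ p)
        (-p * (1 / (y - (n + 1)) ^ (p + 1) + 1 / (y + (n + 1)) ^ (p + 1))) y := by
    intro p n y hy
    have h1 := hasDerivAt_one_div_add_pow (d := -((n : ℝ) + 1)) (x := y)
      (by rw [← sub_eq_add_neg]; exact hneg n y hy) p
    have h2 := hasDerivAt_one_div_add_pow (hpos n y hy) p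
    simp only [← sub_eq_add_neg] at h1
    convert! h1.add h2 using 1
    ring
  have hbound : ∀ (p n : ℕ), ∀ y ∈ Set.Ioo (0 : ℝ) 1,
      |-p * (1 / (y - (n + 1)) ^ (p + 1) + 1 / (y + (n + 1)) ^ (p + 1))| ≤
        2 * p / (n + 1 - y) ^ (p + 1) := by
    intro p n y hy
    have h0 : (0 : ℝ) < n + 1 - y := by linarith [hy.2, n.cast_nonneg (α := ℝ)]
    have h1 : |1 / (y - (n + 1)) ^ (p + 1)| = 1 / (n + 1 - y) ^ (p + 1) := by
      rw [abs_div, abs_pow, abs_one, abs_sub_comm, abs_of_pos h0]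
    have h2 : |1 / (y + (n + 1)) ^ (p + 1)| ≤ 1 / (n + 1 - y) ^ (p + 1) := by
      rw [abs_div, abs_pow, abs_one, abs_of_pos (by linarith [hy.1])]
      gcongr
      linarith [hy.1]
    rw [abs_mul, abs_neg, Nat.abs_cast]
    calc (p : ℝ) * |1 / (y - (n + 1)) ^ (p + 1) + 1 / (y + (n + 1)) ^ (p + 1)|
        ≤ p * (1 / (n + 1 - y) ^ (p + 1) + 1 / (n + 1 - y) ^ (p + 1)) := by
          gcongr
          exact (abs_add_le _ _).trans (add_le_add h1.le h2)
      _ = 2 * p / (n + 1 - y) ^ (p + 1) := by ring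
  have h0 : Set.EqOn (fun y => π * (cos (π * y) / sin (π * y)) - 1 / y)
      (fun y => ∑' n : ℕ, (1 / (y - (n + 1)) ^ 1 + 1 / (y + (n + 1)) ^ 1)) (Set.Ioo 0 1) :=
    fun y hy => by simpa using (pi_mul_cot_hasSum hy).tsum_eq.symm
  have h1 := eqOn_of_hasDerivAt isOpen_Ioo h0
    (f' := fun y => π * (-1 / sin (π * y) ^ 2 * π) - (-((1 : ℕ) : ℝ) / (y + 0) ^ (1 + 1)))
    (fun y hy => by
      have := hasDerivAt_one_div_add_pow (x := y) (d := 0) (by simpa using hy.1.ne') 1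
      simp only [add_zero, pow_one] at this ⊢
      exact (((hasDerivAt_cot (hsin y hy)).comp y (hpi y)).const_mul π).sub this)
    (fun y hy => hasDerivAt_tsum_of_bound_Ioo (p := 2) le_rfl (hder 1) (hbound 1)
      (fun z hz => by simpa using (pi_mul_cot_hasSum hz).summable) hy)
  have h2 := eqOn_of_hasDerivAt isOpen_Ioo h1
    (f' := fun y => π * (2 * cos (π * y) / sin (π * y) ^ 3 * π * π)
      + (-((2 : ℕ) : ℝ) / (y + 0) ^ (2 + 1)))
    (fun y hy => by
      have := hasDerivAt_one_div_add_pow (x := y) (d := 0) (by simpa using hy.1.ne') 2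
      convert! ((((hasDerivAt_neg_one_div_sin_sq (hsin y hy)).comp y (hpi y)).mul_const π).const_mul
        π).add this using 1
      ext z
      simp
      ring)
    (fun y hy => hasDerivAt_tsum_of_bound_Ioo (p := 3) (by norm_num)
      (fun n z hz => (hder 2 n z hz).const_mul (-((1 : ℕ) : ℝ)))
      (fun n z hz => by
        rw [Nat.cast_one, neg_one_mul, abs_neg]
        exact hbound 2 n z hz)
      (fun z hz => (tsum_one_div_add_intCast_pow z le_rfl).1.mul_left _) hy)
  have hsum := summable_one_div_add_intCast_pow x (p := 3) (by norm_num)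
  have htsum := (tsum_one_div_add_intCast_pow x (p := 3) (by norm_num)).2
  have h3 := h2 hx
  simp only [tsum_mul_left] at h3
  have h4 := hsum.hasSum.mul_left 2
  rw [htsum] at h4
  convert! h4 using 1
  · ext m; ring
  · simp only [add_zero] at h3
    push_cast at h3
    norm_num at h3 ⊢
    linear_combination h3

lemma hasSum_two_div_add_intCast_mul_pi_cube {d : ℝ} (hd : d ∈ Set.Ioo 0 π) :
    HasSum (fun m : ℤ => 2 / (d + m * π) ^ 3) (2 * cos d / sin d ^ 3) := by
  have hpi := pi_pos
  have h := (hasSum_two_div_add_intCast_cube (x := d / π)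
    ⟨div_pos hd.1 hpi, (div_lt_one hpi).2 hd.2⟩).mul_left (1 / π ^ 3)
  rw [mul_div_cancel₀ d hpi.ne'] at h
  convert! h using 1
  · ext m
    rw [show d + m * π = π * (d / π + m) by field_simp, mul_pow]
    field_simp
  · field_simp

/-- A series over the integers can be summed along the residue classes modulo `N`. -/
lemma hasSum_int_of_hasSum_residues {N : ℕ} (hN : 0 < N) {f : ℤ → ℝ} {b : ℕ → ℝ}
    (h : ∀ r < N, HasSum (fun m : ℤ => f (r + m * N)) (b r)) :
    HasSum f (∑ r ∈ Finset.range N, b r) := by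
  have hN' : (0 : ℤ) < N := by exact_mod_cast hN
  have key : ∀ r ∈ Finset.range N,
      HasSum (fun k : ℤ => if k % N = r then f k else 0) (b r) := by
    intro r hr
    rw [Finset.mem_range] at hr
    have hmod : ∀ m : ℤ, ((r : ℤ) + m * N) % N = r := fun m => by
      rw [Int.add_mul_emod_self_right, Int.emod_eq_of_lt (by omega) (by exact_mod_cast hr)]
    have hinj : Function.Injective fun m : ℤ => (r : ℤ) + m * N := fun m m' hm => by
      simpa [hN.ne'] using hm
    rw [← hinj.hasSum_iff]
    · refine (h r hr).congr_fun fun m => ?_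
      simp [hmod]
    · intro k hk
      rw [if_neg]
      intro hkr
      exact hk ⟨k / N, by simp only [← hkr]; rw [mul_comm]; exact Int.emod_add_mul_ediv k N⟩
  refine (hasSum_sum key).congr_fun fun k => ?_
  have h1 : ((k % N).toNat : ℤ) = k % N := Int.toNat_of_nonneg (Int.emod_nonneg k hN'.ne')
  rw [Finset.sum_eq_single_of_mem (k % N).toNat]
  · rw [if_pos h1.symm]
  · rw [Finset.mem_range]
    have := Int.emod_lt_of_pos k hN'
    omega
  · intro r _ hr
    rw [if_neg]
    omega

/-- The third order logarithmic derivative of `y ↦ K * sin (y - y₀) * ∏ sin (y - v i)` at the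
simple zero `y₀`, expressed through the derivatives of this function. -/
lemma sum_two_mul_cos_div_sin_cube {ι : Type*} (s : Finset ι) (v : ι → ℝ) (y₀ K : ℝ)
    {f f₁ f₂ f₃ f₄ : ℝ → ℝ} (hf : ∀ y, f y = K * (sin (y - y₀) * ∏ i ∈ s, sin (y - v i)))
    (h₁ : ∀ y, HasDerivAt f (f₁ y) y) (h₂ : ∀ y, HasDerivAt f₁ (f₂ y) y)
    (h₃ : ∀ y, HasDerivAt f₂ (f₃ y) y) (h₄ : ∀ y, HasDerivAt f₃ (f₄ y) y)
    (hv : ∀ i ∈ s, sin (y₀ - v i) ≠ 0) :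
    4 * f₁ y₀ ^ 3 * ∑ i ∈ s, 2 * cos (y₀ - v i) / sin (y₀ - v i) ^ 3 =
      f₄ y₀ * f₁ y₀ ^ 2 - 2 * f₁ y₀ * f₂ y₀ * f₃ y₀ + f₂ y₀ ^ 3 := by
  classical
  set U : Set ℝ := {y | ∏ i ∈ s, sin (y - v i) ≠ 0}
  have hU : IsOpen U := isOpen_ne_fun (by fun_prop) continuous_const
  have hy₀ : y₀ ∈ U := Finset.prod_ne_zero_iff.2 hv
  have hs : ∀ y ∈ U, ∀ i ∈ s, sin (y - v i) ≠ 0 := fun y hy => Finset.prod_ne_zero_iff.1 hy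
  set Q : ℝ → ℝ := fun y => ∏ i ∈ s, sin (y - v i) with hQdef
  set G : ℝ → ℝ := fun y => ∑ i ∈ s, cos (y - v i) / sin (y - v i) with hGdef
  set G₁ : ℝ → ℝ := fun y => ∑ i ∈ s, -1 / sin (y - v i) ^ 2 with hG₁def
  set G₂ : ℝ → ℝ := fun y => ∑ i ∈ s, 2 * cos (y - v i) / sin (y - v i) ^ 3 with hG₂def
  have hQ : ∀ y ∈ U, HasDerivAt Q (Q y * G y) y := by
    intro y hy
    convert! HasDerivAt.fun_finsetProd (u := s) (fun i _ =>
      (hasDerivAt_sin (y - v i)).comp_sub_const y (v i)) using 1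
    change (∏ i ∈ s, sin (y - v i)) * ∑ i ∈ s, cos (y - v i) / sin (y - v i) = _
    rw [Finset.mul_sum]
    refine Finset.sum_congr rfl fun i hi => ?_
    rw [← Finset.prod_erase_mul s _ hi, smul_eq_mul]
    have := hs y hy i hi
    field_simp
  have hG : ∀ y ∈ U, HasDerivAt G (G₁ y) y := fun y hy =>
    HasDerivAt.fun_sum fun i hi => (hasDerivAt_cot (hs y hy i hi)).comp_sub_const y (v i)
  have hG₁ : ∀ y ∈ U, HasDerivAt G₁ (G₂ y) y := fun y hy =>
    HasDerivAt.fun_sum fun i hi =>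
      (hasDerivAt_neg_one_div_sin_sq (hs y hy i hi)).comp_sub_const y (v i)
  have hG₂ : ∀ y ∈ U, ∃ d, HasDerivAt G₂ d y := fun y hy =>
    ⟨_, HasDerivAt.fun_sum fun i hi =>
      ((differentiableAt_two_mul_cos_div_sin_cube (hs y hy i hi)).hasDerivAt).comp_sub_const y
        (v i)⟩
  choose! G₃ hG₃ using hG₂
  have hσ : ∀ y, HasDerivAt (fun z => sin (z - y₀)) (cos (y - y₀)) y := fun y =>
    (hasDerivAt_sin (y - y₀)).comp_sub_const y y₀
  have hχ : ∀ y, HasDerivAt (fun z => cos (z - y₀)) (-sin (y - y₀)) y := fun y =>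
    (hasDerivAt_cos (y - y₀)).comp_sub_const y y₀
  have e₁ := eqOn_of_hasDerivAt hU (fun y _ => hf y) (fun y _ => h₁ y)
    (g' := fun y => K * Q y * (cos (y - y₀) + sin (y - y₀) * G y)) (fun y hy => by
      convert! ((hσ y).mul (hQ y hy)).const_mul K using 1
      ring)
  have e₂ := eqOn_of_hasDerivAt hU e₁ (fun y _ => h₂ y)
    (g' := fun y => K * Q y * (-sin (y - y₀) + 2 * cos (y - y₀) * G y
      + sin (y - y₀) * (G y ^ 2 + G₁ y))) (fun y hy => by
      convert! ((hQ y hy).const_mul K).mul ((hχ y).add ((hσ y).mul (hG y hy))) using 1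
      simp only [Pi.mul_apply, Pi.add_apply]
      ring)
  have e₃ := eqOn_of_hasDerivAt hU e₂ (fun y _ => h₃ y)
    (g' := fun y => K * Q y * (-cos (y - y₀) - 3 * sin (y - y₀) * G y
      + 3 * cos (y - y₀) * (G y ^ 2 + G₁ y)
      + sin (y - y₀) * (G y ^ 3 + 3 * G y * G₁ y + G₂ y))) (fun y hy => by
      convert! ((hQ y hy).const_mul K).mul (((hσ y).neg.add (((hχ y).const_mul 2).mul (hG y hy))).add
        ((hσ y).mul (((hG y hy).fun_pow 2).add (hG₁ y hy)))) using 1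
      simp only [Pi.mul_apply, Pi.add_apply, Pi.neg_apply]
      push_cast
      ring)
  have e₄ := eqOn_of_hasDerivAt hU e₃ (fun y _ => h₄ y)
    (fun y hy => 
      ((hQ y hy).const_mul K).mul ((((hχ y).neg.sub (((hσ y).const_mul 3).mul (hG y hy))).add
        (((hχ y).const_mul 3).mul (((hG y hy).fun_pow 2).add (hG₁ y hy)))).add
        ((hσ y).mul ((((hG y hy).fun_pow 3).add (((hG y hy).const_mul 3).mul (hG₁ y hy))).add
          (hG₃ y hy)))))
  have e₁' := e₁ hy₀
  have e₂' := e₂ hy₀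
  have e₃' := e₃ hy₀
  have e₄' := e₄ hy₀
  simp only [Pi.add_apply, sub_self, sin_zero,
    cos_zero] at e₁' e₂' e₃' e₄'
  rw [e₁', e₂', e₃', e₄']
  change 4 * _ ^ 3 * G₂ y₀ = _
  push_cast
  ring

open Polynomial in
/-- The trigonometric polynomial `sin ((n + 1) y + τ) - ν sin ((n - 1) y + τ)` factors over
any `n + 1` of its zeros that are distinct modulo `π`. -/
lemma exists_sin_sub_sin_eq_mul_prod_sin {n : ℕ} (hn : 1 ≤ n) (ν τ : ℝ) (v : ℕ → ℝ)
    (hv : ∀ i ≤ n, sin ((n + 1) * v i + τ) - ν * sin ((n - 1) * v i + τ) = 0)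
    (hinj : ∀ i ≤ n, ∀ j ≤ n, i ≠ j → sin (v i - v j) ≠ 0) :
    ∃ K : ℝ, ∀ y : ℝ, sin ((n + 1) * y + τ) - ν * sin ((n - 1) * y + τ) =
      K * ∏ i ∈ Finset.range (n + 1), sin (y - v i) := by
  set z : ℝ → ℂ := fun y => Complex.exp (2 * y * Complex.I) with hz
  set w : ℂ := Complex.exp (-(2 * τ * Complex.I)) with hw
  set R : ℂ[X] := C (-(ν : ℂ)) * X ^ n + C (w * ν) * X + C (-w) with hR
  have hRdeg : R.degree ≤ n := by
    have h1 : (1 : WithBot ℕ) ≤ n := by exact_mod_cast hn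
    refine (degree_add_le _ _).trans (max_le ((degree_add_le _ _).trans (max_le ?_ ?_)) ?_)
    · exact degree_C_mul_X_pow_le _ _
    · exact (degree_C_mul_X_le _).trans h1
    · exact degree_C_le.trans (zero_le_one.trans h1)
  have hPmonic : (X ^ (n + 1) + R).Monic := monic_X_pow_add (hRdeg.trans_lt (by
    exact_mod_cast n.lt_succ_self))
  have hPdeg : (X ^ (n + 1) + R).degree = ((n + 1 : ℕ) : WithBot ℕ) := by
    rw [degree_add_eq_left_of_degree_lt, degree_X_pow]
    rw [degree_X_pow]
    exact hRdeg.trans_lt (by exact_mod_cast n.lt_succ_self)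
  have hF : ∀ y : ℝ, ((sin ((n + 1) * y + τ) - ν * sin ((n - 1) * y + τ) : ℝ) : ℂ) =
      Complex.exp (τ * Complex.I) / (2 * Complex.I) *
        (Complex.exp (-((n + 1) * y * Complex.I)) * (X ^ (n + 1) + R).eval (z y)) := by
    intro y
    obtain ⟨k, rfl⟩ := Nat.exists_eq_add_of_le' hn
    have h1 : Complex.exp (((k + 1 : ℕ) + 1) * y * Complex.I) =
        Complex.exp (y * Complex.I) ^ (k + 2) := by
      rw [← Complex.exp_nat_mul]; push_cast; ring_nf
    have h2 : Complex.exp (((k + 1 : ℕ) - 1) * y * Complex.I) =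
        Complex.exp (y * Complex.I) ^ k := by
      rw [← Complex.exp_nat_mul]; push_cast; ring_nf
    have h3 : z y = Complex.exp (y * Complex.I) ^ 2 := by
      rw [hz, ← Complex.exp_nat_mul]; push_cast; ring_nf
    have h4 : w = (Complex.exp (τ * Complex.I) ^ 2)⁻¹ := by
      rw [hw, ← Complex.exp_nat_mul, ← Complex.exp_neg]; push_cast; ring_nf
    push_cast [Complex.sin]
    push_cast at h1 h2
    simp only [neg_mul, add_mul _ _ Complex.I, Complex.exp_add, Complex.exp_neg, h1, h2, hR,
      eval_add, eval_mul, eval_pow, eval_C, eval_X, h3, h4]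
    have := Complex.exp_ne_zero (y * Complex.I)
    have := Complex.exp_ne_zero (τ * Complex.I)
    have := Complex.I_ne_zero
    field_simp
    rw [Complex.I_sq]
    ring
  have hsin : ∀ y i, ((sin (y - v i) : ℝ) : ℂ) =
      (Complex.exp (-(y * Complex.I)) * (z y - z (v i))) *
        (Complex.exp (-(v i * Complex.I)) / (2 * Complex.I)) := by
    intro y i
    have h1 : ∀ x : ℝ, z x = Complex.exp (x * Complex.I) ^ 2 := fun x => by
      rw [hz, ← Complex.exp_nat_mul]; push_cast; ring_nf
    push_cast [Complex.sin]
    simp only [neg_mul, sub_mul, Complex.exp_sub, Complex.exp_neg, h1]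
    have := Complex.exp_ne_zero (y * Complex.I)
    have := Complex.exp_ne_zero (v i * Complex.I)
    have := Complex.I_ne_zero
    field_simp
    rw [Complex.I_sq]
    ring
  have hP : X ^ (n + 1) + R = ∏ i ∈ Finset.range (n + 1), (X - C (z (v i))) := by
    have hQmonic : (∏ i ∈ Finset.range (n + 1), (X - C (z (v i)))).Monic :=
      monic_prod_of_monic _ _ fun i _ => monic_X_sub_C _
    have hQdeg : (∏ i ∈ Finset.range (n + 1), (X - C (z (v i)))).degree = ((n + 1 : ℕ) : WithBot ℕ) := by
      rw [degree_prod]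
      simp
    apply eq_of_degree_sub_lt_of_eval_index_eq (Finset.range (n + 1)) (v := fun i => z (v i))
    · intro i hi j hj hij
      by_contra hne
      simp only [Finset.coe_range, Set.mem_Iio] at hi hj
      have := hsin (v i) j
      rw [show z (v i) = z (v j) from hij] at this
      simp only [sub_self, mul_zero, zero_mul] at this
      exact hinj i (by omega) j (by omega) hne (by exact_mod_cast this)
    · rw [Finset.card_range, ← hPdeg]
      exact degree_sub_lt_left (hPdeg.trans hQdeg.symm) hPmonic.ne_zero
        (hPmonic.leadingCoeff.trans hQmonic.leadingCoeff.symm)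
    · intro i hi
      have h := hF (v i)
      rw [hv i (Finset.mem_range_succ_iff.1 hi)] at h
      rw [eval_prod, Finset.prod_eq_zero hi (by simp)]
      simpa using h.symm
  refine ⟨(Complex.exp (τ * Complex.I) / (2 * Complex.I) /
    ∏ i ∈ Finset.range (n + 1), (Complex.exp (-(v i * Complex.I)) / (2 * Complex.I))).re,
    fun y => ?_⟩
  have hprod : (∏ i ∈ Finset.range (n + 1), (Complex.exp (-(v i * Complex.I)) / (2 * Complex.I)))
      ≠ 0 := Finset.prod_ne_zero_iff.2 fun i _ => by simp
  have hexp : Complex.exp (-((n + 1) * y * Complex.I)) =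
      Complex.exp (-(y * Complex.I)) ^ (n + 1) := by
    rw [← Complex.exp_nat_mul]
    push_cast
    ring_nf
  have h := hF y
  rw [hP, eval_prod, hexp] at h
  rw [← Complex.re_mul_ofReal, ← Complex.ofReal_re (sin _ - _), h]
  congr 1
  push_cast
  simp only [← Complex.ofReal_sub, ← Complex.ofReal_sin]
  rw [Finset.prod_congr rfl fun i _ => hsin y i, Finset.prod_mul_distrib, Finset.prod_mul_distrib]
  simp only [eval_sub, eval_X, eval_C, Finset.prod_const, Finset.card_range]
  generalize (∏ i ∈ Finset.range (n + 1), (Complex.exp (-(v i * Complex.I)) / (2 * Complex.I))) = D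
    at hprod ⊢
  field_simp

/-- The phase `θ` with `tan (y + θ) = (1 + ν) / (1 - ν) * tan y`. -/
noncomputable def phaseShift (ν y : ℝ) : ℝ :=
  arctan (ν * sin (2 * y) / (1 - ν * cos (2 * y)))

section phaseShift

variable {ν : ℝ}

lemma one_sub_mul_cos_pos (hν : |ν| < 1) (x : ℝ) : 0 < 1 - ν * cos x := by
  have h : |ν * cos x| < 1 := by
    rw [abs_mul]
    exact (mul_le_of_le_one_right (abs_nonneg ν) (abs_cos_le_one x)).trans_lt hν
  linarith [(abs_lt.1 h).2]

lemma one_sub_two_mul_cos_add_sq_pos (hν : |ν| < 1) (x : ℝ) :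
    0 < 1 - 2 * ν * cos x + ν ^ 2 := by
  have h := one_sub_mul_cos_pos hν x
  nlinarith [sin_sq_add_cos_sq x, sq_nonneg (ν * sin x), mul_pos h h]

lemma exists_cos_sin_phaseShift (hν : |ν| < 1) (y : ℝ) :
    ∃ q > 0, q ^ 2 * (1 - 2 * ν * cos (2 * y) + ν ^ 2) = 1 ∧
      cos (phaseShift ν y) = (1 - ν * cos (2 * y)) * q ∧
      sin (phaseShift ν y) = ν * sin (2 * y) * q := by
  have h := one_sub_mul_cos_pos hν (2 * y)
  have hcos := cos_arctan_pos (ν * sin (2 * y) / (1 - ν * cos (2 * y)))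
  have htan := tan_arctan (ν * sin (2 * y) / (1 - ν * cos (2 * y)))
  change 0 < cos (phaseShift ν y) at hcos
  change tan (phaseShift ν y) = _ at htan
  rw [tan_eq_sin_div_cos, div_eq_iff hcos.ne'] at htan
  refine ⟨cos (phaseShift ν y) / (1 - ν * cos (2 * y)), div_pos hcos h, ?_, ?_, ?_⟩
  · have h1 := sin_sq_add_cos_sq (phaseShift ν y)
    have h2 := sin_sq_add_cos_sq (2 * y)
    rw [htan] at h1
    field_simp at h1 ⊢
    linear_combination h1 - ν ^ 2 * cos (phaseShift ν y) ^ 2 * h2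
  · field_simp
  · rw [htan]
    field_simp

lemma hasDerivAt_phaseShift (hν : |ν| < 1) (y : ℝ) :
    HasDerivAt (phaseShift ν)
      ((1 - ν ^ 2) / (1 - 2 * ν * cos (2 * y) + ν ^ 2) - 1) y := by
  have h := one_sub_mul_cos_pos hν (2 * y)
  have hE := one_sub_two_mul_cos_add_sq_pos hν (2 * y)
  have h2 : HasDerivAt (fun z : ℝ => 2 * z) 2 y := by
    simpa using (hasDerivAt_id y).const_mul 2
  have hs := ((hasDerivAt_sin (2 * y)).comp y h2).const_mul ν
  have hc := ((hasDerivAt_cos (2 * y)).comp y h2).const_mul ν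
  convert! (hs.div (hc.const_sub 1) h.ne').arctan using 1
  simp only [Function.comp, Pi.div_apply]
  have h1 := sin_sq_add_cos_sq (2 * y)
  have h3 : 0 < (1 - ν * cos (2 * y)) ^ 2 + ν ^ 2 * sin (2 * y) ^ 2 := by positivity
  have h4 : (1 - 2 * ν * cos (2 * y) + ν ^ 2) =
      (1 - ν * cos (2 * y)) ^ 2 + ν ^ 2 * sin (2 * y) ^ 2 := by
    linear_combination -ν ^ 2 * h1
  rw [h4]
  field_simp
  linear_combination (ν ^ 2) * h1

lemma phaseShift_neg (y : ℝ) : phaseShift ν (-y) = -phaseShift ν y := by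
  simp [phaseShift, ← arctan_neg, neg_div]

lemma phaseShift_add_pi (y : ℝ) : phaseShift ν (y + π) = phaseShift ν y := by
  simp [phaseShift, mul_add]

lemma strictMono_mul_add_phaseShift (hν : |ν| < 1) {b : ℝ} (hb : 1 ≤ b) :
    StrictMono fun y => b * y + phaseShift ν y := by
  refine strictMono_of_hasDerivAt_pos (fun y =>
    ((hasDerivAt_id y).const_mul b).add (hasDerivAt_phaseShift hν y)) fun y => ?_
  have : 0 < (1 - ν ^ 2) / (1 - 2 * ν * cos (2 * y) + ν ^ 2) :=
    div_pos (by linarith [(sq_lt_one_iff_abs_lt_one ν).2 hν])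
      (one_sub_two_mul_cos_add_sq_pos hν (2 * y))
  linarith

lemma continuous_phaseShift (hν : |ν| < 1) : Continuous (phaseShift ν) :=
  continuous_iff_continuousAt.2 fun y => (hasDerivAt_phaseShift hν y).continuousAt

lemma surjective_mul_add_phaseShift (hν : |ν| < 1) {b : ℝ} (hb : 1 ≤ b) :
    Function.Surjective fun y => b * y + phaseShift ν y := by
  have hb' : 0 < b := by linarith
  refine Continuous.surjective ((continuous_const_mul b).add (continuous_phaseShift hν)) ?_ ?_
  · exact tendsto_atTop_mono (fun y => add_le_add_right (neg_pi_div_two_lt_arctan _).le _)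
      (tendsto_atTop_add_const_right _ _ (tendsto_id.const_mul_atTop hb'))
  · exact tendsto_atBot_mono (fun y => add_le_add_right (arctan_lt_pi_div_two _).le _)
      (tendsto_atBot_add_const_right _ _ (tendsto_id.const_mul_atBot hb'))

lemma tan_add_phaseShift (hν : |ν| < 1) (y : ℝ) :
    tan (y + phaseShift ν y) = (1 + ν) / (1 - ν) * tan y := by
  obtain ⟨q, hq, -, hc, hs⟩ := exists_cos_sin_phaseShift hν y
  have h1 : sin (y + phaseShift ν y) = q * ((1 + ν) * sin y) := by
    rw [sin_add, hc, hs, cos_two_mul, sin_two_mul]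
    ring
  have h2 : cos (y + phaseShift ν y) = q * ((1 - ν) * cos y) := by
    rw [cos_add, hc, hs, cos_two_mul, sin_two_mul]
    linear_combination (-2 * ν * q * cos y) * sin_sq_add_cos_sq y
  rw [tan_eq_sin_div_cos, h1, h2, mul_div_mul_left _ _ hq.ne', tan_eq_sin_div_cos,
    mul_div_mul_comm]

lemma sin_phaseShift_eq (hν : |ν| < 1) (y : ℝ) :
    sin (phaseShift ν y) = ν * sin (phaseShift ν y + 2 * y) := by
  obtain ⟨q, hq, -, hc, hs⟩ := exists_cos_sin_phaseShift hν y
  rw [sin_add, hc, hs]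
  ring

end phaseShift

section waveAngle

variable {ν : ℝ} {n : ℕ} {Y : ℝ → ℝ}

lemma exists_waveAngle (hν : |ν| < 1) (n : ℕ) :
    ∃ Y : ℝ → ℝ, StrictMono Y ∧ Continuous Y ∧
      ∀ s, (n + 1) * Y s + phaseShift ν (Y s) = π * s := by
  have hb : (1 : ℝ) ≤ n + 1 := by linarith [n.cast_nonneg (α := ℝ)]
  let e := (strictMono_mul_add_phaseShift hν hb).orderIsoOfSurjective _
    (surjective_mul_add_phaseShift hν hb)
  refine ⟨fun s => e.symm (π * s), fun s t hst => e.symm.strictMono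
    (mul_lt_mul_of_pos_left hst pi_pos), e.symm.continuous.comp (continuous_const_mul π),
    fun s => ?_⟩
  exact e.apply_symm_apply (π * s)

lemma waveAngle_eq (hν : |ν| < 1) (hY : ∀ s, (n + 1) * Y s + phaseShift ν (Y s) = π * s)
    {s y : ℝ} (h : (n + 1) * y + phaseShift ν y = π * s) : Y s = y :=
  (strictMono_mul_add_phaseShift hν (b := n + 1) (by linarith [n.cast_nonneg (α := ℝ)])).injective
    ((hY s).trans h.symm)

lemma waveAngle_neg (hν : |ν| < 1) (hY : ∀ s, (n + 1) * Y s + phaseShift ν (Y s) = π * s)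
    (s : ℝ) : Y (-s) = -Y s :=
  waveAngle_eq hν hY (by rw [phaseShift_neg]; linear_combination -hY s)

lemma waveAngle_add (hν : |ν| < 1) (hY : ∀ s, (n + 1) * Y s + phaseShift ν (Y s) = π * s)
    (s : ℝ) : Y (s + (n + 1)) = Y s + π :=
  waveAngle_eq hν hY (by rw [phaseShift_add_pi]; linear_combination hY s)

lemma waveAngle_add_int_mul (hν : |ν| < 1)
    (hY : ∀ s, (n + 1) * Y s + phaseShift ν (Y s) = π * s) (s : ℝ) (m : ℤ) :
    Y (s + m * (n + 1)) = Y s + m * π := by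
  have h : Function.Periodic (fun s => Y s - π / (n + 1) * s) (n + 1) := fun s => by
    have : (n : ℝ) + 1 ≠ 0 := by positivity
    simp only [waveAngle_add hν hY]
    field_simp
    ring
  have h1 := h.int_mul m s
  have : (n : ℝ) + 1 ≠ 0 := by positivity
  field_simp at h1
  apply mul_left_cancel₀ this
  linear_combination h1

lemma hasDerivAt_waveAngle (hν : |ν| < 1) (hcont : Continuous Y)
    (hY : ∀ s, (n + 1) * Y s + phaseShift ν (Y s) = π * s) (s : ℝ) :
    HasDerivAt Y (π / (n + (1 - ν ^ 2) / (1 - 2 * ν * cos (2 * Y s) + ν ^ 2))) s := by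
  have hpos : 0 < (1 - ν ^ 2) / (1 - 2 * ν * cos (2 * Y s) + ν ^ 2) :=
    div_pos (by linarith [(sq_lt_one_iff_abs_lt_one ν).2 hν])
      (one_sub_two_mul_cos_add_sq_pos hν _)
  have h := (((hasDerivAt_id (Y s)).const_mul ((n : ℝ) + 1)).add
    (hasDerivAt_phaseShift hν (Y s))).div_const π
  have h1 := HasDerivAt.of_local_left_inverse hcont.continuousAt h (by
    have := n.cast_nonneg (α := ℝ)
    have := pi_pos
    apply ne_of_gt
    apply div_pos _ pi_pos
    linarith) (Eventually.of_forall fun y => by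
      simp only [Pi.add_apply, id]
      rw [hY, mul_div_cancel_left₀ _ pi_pos.ne'])
  convert! h1 using 1
  rw [inv_div]
  congr 1
  ring

lemma hasDerivAt_deriv_waveAngle (hν : |ν| < 1) (hcont : Continuous Y)
    (hY : ∀ s, (n + 1) * Y s + phaseShift ν (Y s) = π * s) (s : ℝ) :
    HasDerivAt (fun s => π / (n + (1 - ν ^ 2) / (1 - 2 * ν * cos (2 * Y s) + ν ^ 2)))
      (4 * π ^ 2 * (1 - ν ^ 2) * (ν * sin (2 * Y s)) * (1 - 2 * ν * cos (2 * Y s) + ν ^ 2) /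
        (n * (1 - 2 * ν * cos (2 * Y s) + ν ^ 2) + (1 - ν ^ 2)) ^ 3) s := by
  have hν' : 0 < 1 - ν ^ 2 := by linarith [(sq_lt_one_iff_abs_lt_one ν).2 hν]
  have hE := one_sub_two_mul_cos_add_sq_pos hν (2 * Y s)
  have hn := n.cast_nonneg (α := ℝ)
  have h0 : 0 < n + (1 - ν ^ 2) / (1 - 2 * ν * cos (2 * Y s) + ν ^ 2) := by positivity
  have h1 : HasDerivAt (fun s => 1 - 2 * ν * cos (2 * Y s) + ν ^ 2)
      (-(2 * ν * (-sin (2 * Y s) *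
        (2 * (π / (n + (1 - ν ^ 2) / (1 - 2 * ν * cos (2 * Y s) + ν ^ 2))))))) s :=
    ((((hasDerivAt_waveAngle hν hcont hY s).const_mul 2).cos.const_mul (2 * ν)).const_sub
      1).add_const _
  convert! (hasDerivAt_const s π).div
    (((hasDerivAt_const s (1 - ν ^ 2)).div h1 hE.ne').const_add (n : ℝ)) h0.ne' using 1
  simp only [Pi.div_apply]
  generalize 1 - 2 * ν * cos (2 * Y s) + ν ^ 2 = E at *
  have h2 : 0 < n * E + (1 - ν ^ 2) := by positivity
  field_simp
  ring

lemma sin_waveAngle_sub_eq_zero (hν : |ν| < 1)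
    (hY : ∀ s, (n + 1) * Y s + phaseShift ν (Y s) = π * s) (s : ℝ) (i : ℕ) :
    sin ((n + 1) * Y (s + i) + -(π * s)) - ν * sin ((n - 1) * Y (s + i) + -(π * s)) = 0 := by
  have h := hY (s + i)
  rw [show (n + 1) * Y (s + i) + -(π * s) = -phaseShift ν (Y (s + i)) + i * π by
      linear_combination h,
    show (n - 1) * Y (s + i) + -(π * s) = -(phaseShift ν (Y (s + i)) + 2 * Y (s + i)) + i * π by
      linear_combination h,
    sin_add_nat_mul_pi, sin_add_nat_mul_pi, sin_neg, sin_neg]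
  linear_combination (-(-1) ^ i) * sin_phaseShift_eq hν (Y (s + i))

lemma waveAngle_sub_mem_Ioo (hν : |ν| < 1) (hmono : StrictMono Y)
    (hY : ∀ s, (n + 1) * Y s + phaseShift ν (Y s) = π * s) (s : ℝ) {i j : ℕ} (hij : i < j)
    (hj : j ≤ n) : Y (s + j) - Y (s + i) ∈ Set.Ioo 0 π := by
  have h1 : (i : ℝ) < j := by exact_mod_cast hij
  have h2 : (j : ℝ) ≤ n := by exact_mod_cast hj
  have h3 := hmono (show s + i < s + j by linarith)
  have h4 := hmono (show s + j < s + i + (n + 1) by linarith [i.cast_nonneg (α := ℝ)])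
  rw [waveAngle_add hν hY] at h4
  constructor <;> linarith

/-- The force exerted on a particle by the other particles of one period. -/
lemma sum_force_waveAngle (hν : |ν| < 1) (hn : 1 ≤ n) (hmono : StrictMono Y)
    (hY : ∀ s, (n + 1) * Y s + phaseShift ν (Y s) = π * s) (s : ℝ) :
    ∑ i ∈ Finset.range n, 2 * cos (Y s - Y (s + (i + 1 : ℕ))) /
        sin (Y s - Y (s + (i + 1 : ℕ))) ^ 3 =
      4 * n ^ 2 * (ν * sin (2 * Y s)) * (1 - 2 * ν * cos (2 * Y s) + ν ^ 2) *
          ((n + 1) ^ 2 - (n - 1) ^ 2 * ν ^ 2) /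
        (n * (1 - 2 * ν * cos (2 * Y s) + ν ^ 2) + (1 - ν ^ 2)) ^ 3 := by
  have hsin : ∀ i ≤ n, ∀ j ≤ n, i < j → sin (Y (s + j) - Y (s + i)) ≠ 0 :=
    fun i _ j hj hij => by
      have h := waveAngle_sub_mem_Ioo hν hmono hY s hij hj
      exact (sin_pos_of_pos_of_lt_pi h.1 h.2).ne'
  have hsin' : ∀ i ≤ n, ∀ j ≤ n, i < j → sin (Y (s + i) - Y (s + j)) ≠ 0 :=
    fun i hi j hj hij => by
      rw [← neg_sub, sin_neg]
      exact neg_ne_zero.2 (hsin i hi j hj hij)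
  obtain ⟨K, hK⟩ := exists_sin_sub_sin_eq_mul_prod_sin hn ν (-(π * s)) (fun i : ℕ => Y (s + i))
    (fun i _ => sin_waveAngle_sub_eq_zero hν hY s i)
    (fun i hi j hj hij => (lt_or_gt_of_ne hij).elim (hsin' i hi j hj) (hsin j hj i hi))
  have hlin : ∀ b y : ℝ, HasDerivAt (fun y => b * y + -(π * s)) b y := fun b y => by
    simpa using ((hasDerivAt_id y).const_mul b).add_const (-(π * s))
  have hder_sin : ∀ b α y : ℝ, HasDerivAt (fun y => α * sin (b * y + -(π * s)))
      (α * b * cos (b * y + -(π * s))) y := fun b α y => by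
    convert! ((hlin b y).sin).const_mul α using 1
    ring
  have hder_cos : ∀ b α y : ℝ, HasDerivAt (fun y => α * cos (b * y + -(π * s)))
      (-(α * b) * sin (b * y + -(π * s))) y := fun b α y => by
    convert! ((hlin b y).cos).const_mul α using 1
    ring
  have key := sum_two_mul_cos_div_sin_cube (Finset.range n) (fun i : ℕ => Y (s + (i + 1 : ℕ)))
    (Y s) K
    (f := fun y => 1 * sin ((n + 1) * y + -(π * s)) - ν * sin ((n - 1) * y + -(π * s)))
    (fun y => by
      rw [one_mul, hK, Finset.prod_range_succ', mul_comm (sin (y - Y s))]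
      simp)
    (fun y => (hder_sin _ _ y).sub (hder_sin _ _ y))
    (fun y => (hder_cos _ _ y).sub (hder_cos _ _ y))
    (fun y => (hder_sin _ _ y).sub (hder_sin _ _ y))
    (fun y => (hder_cos _ _ y).sub (hder_cos _ _ y))
    (fun i hi => by
      have := hsin' 0 (Nat.zero_le n) (i + 1) (by simpa using hi) (Nat.succ_pos i)
      simpa using this)
  obtain ⟨q, hq, hqE, hc, hs⟩ := exists_cos_sin_phaseShift hν (Y s)
  have e1 : (n + 1) * Y s + -(π * s) = -phaseShift ν (Y s) := by linear_combination hY s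
  have e2 : (n - 1) * Y s + -(π * s) = -(phaseShift ν (Y s) + 2 * Y s) := by
    linear_combination hY s
  have h2y := sin_sq_add_cos_sq (2 * Y s)
  have hcos2 : cos (phaseShift ν (Y s) + 2 * Y s) = q * (cos (2 * Y s) - ν) := by
    rw [cos_add, hc, hs]
    linear_combination -ν * q * h2y
  have hsin2 : sin (phaseShift ν (Y s) + 2 * Y s) = q * sin (2 * Y s) := by
    rw [sin_add, hc, hs]
    ring
  rw [e1, e2, sin_neg, sin_neg, cos_neg, cos_neg, hcos2, hsin2, hc, hs] at key
  have hE := one_sub_two_mul_cos_add_sq_pos hν (2 * Y s)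
  have hν' : 0 < 1 - ν ^ 2 := by linarith [(sq_lt_one_iff_abs_lt_one ν).2 hν]
  have hn0 := n.cast_nonneg (α := ℝ)
  have hW : 0 < n * (1 - 2 * ν * cos (2 * Y s) + ν ^ 2) + (1 - ν ^ 2) := by positivity
  rw [eq_div_iff (pow_pos hW 3).ne']
  generalize (∑ i ∈ Finset.range n, 2 * cos (Y s - Y (s + (i + 1 : ℕ))) /
        sin (Y s - Y (s + (i + 1 : ℕ))) ^ 3) = S at *
  generalize cos (2 * Y s) = C at *
  generalize sin (2 * Y s) = T at *
  apply mul_left_cancel₀ (mul_pos four_pos (pow_pos hq 3)).ne'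
  linear_combination key + (64 * n ^ 3 * ν ^ 3 * T * q ^ 3) * h2y

/-- The total force exerted on a particle by the infinite lattice. -/
lemma hasSum_force_waveAngle (hν : |ν| < 1) (hn : 1 ≤ n) (hmono : StrictMono Y)
    (hY : ∀ s, (n + 1) * Y s + phaseShift ν (Y s) = π * s) (s : ℝ) :
    HasSum (fun i : ℤ => 2 / (Y s - Y (s + i)) ^ 3)
      (4 * n ^ 2 * (ν * sin (2 * Y s)) * (1 - 2 * ν * cos (2 * Y s) + ν ^ 2) *
          ((n + 1) ^ 2 - (n - 1) ^ 2 * ν ^ 2) /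
        (n * (1 - 2 * ν * cos (2 * Y s) + ν ^ 2) + (1 - ν ^ 2)) ^ 3) := by
  rw [← sum_force_waveAngle hν hn hmono hY s]
  have h := hasSum_int_of_hasSum_residues (Nat.succ_pos n)
    (f := fun i : ℤ => 2 / (Y s - Y (s + i)) ^ 3)
    (b := fun r : ℕ => 2 * cos (Y s - Y (s + r)) / sin (Y s - Y (s + r)) ^ 3) ?_
  · rw [Finset.sum_range_succ'] at h
    simpa using h
  intro r hr
  have hterm : ∀ m : ℤ, 2 / (Y s - Y (s + ((r + m * (n + 1 : ℕ) : ℤ) : ℝ))) ^ 3 =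
      -(2 / (Y (s + r) - Y s + m * π) ^ 3) := fun m => by
    push_cast
    rw [← add_assoc, waveAngle_add_int_mul hν hY,
      show Y s - (Y (s + r) + m * π) = -(Y (s + r) - Y s + m * π) by ring, Odd.neg_pow (by decide),
      div_neg]
  simp only [hterm]
  rw [← neg_sub (Y (s + r)) (Y s), cos_neg, sin_neg, Odd.neg_pow (by decide), div_neg]
  apply HasSum.neg
  rcases r.eq_zero_or_pos with rfl | hr0
  · have h0 : Summable fun m : ℤ => 2 / (0 + m * π) ^ 3 := by
      refine ((summable_one_div_add_intCast_pow 0 (p := 3) (by norm_num)).mul_left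
        (2 / π ^ 3)).congr fun m => ?_
      rw [zero_add, zero_add, mul_pow, div_mul_div_comm, mul_one, mul_comm (π ^ 3)]
    have h1 := (Equiv.neg ℤ).hasSum_iff.2 h0.hasSum
    have h2 : (fun m : ℤ => 2 / (0 + (m : ℝ) * π) ^ 3) ∘ (Equiv.neg ℤ) =
        fun m : ℤ => -(2 / (0 + (m : ℝ) * π) ^ 3) := by
      ext m
      simp only [Function.comp, Equiv.neg_apply, Int.cast_neg, zero_add, neg_mul]
      rw [Odd.neg_pow (by decide), div_neg]
    rw [h2] at h1
    have h3 := h1.unique h0.hasSum.neg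
    have h4 := h0.hasSum
    rw [show ∑' m : ℤ, 2 / (0 + (m : ℝ) * π) ^ 3 = 0 by linarith] at h4
    simpa using h4
  · have := waveAngle_sub_mem_Ioo hν hmono hY s hr0 (Nat.lt_succ_iff.1 hr)
    simp only [Nat.cast_zero, add_zero] at this
    exact hasSum_two_div_add_intCast_mul_pi_cube this

end waveAngle

/-- **Periodic traveling waves for the infinite Calogero-Moser lattice.**
Let `N ≥ 2`, `L = N − 1`, `a = π/L`, `c > π + a`,
`ν = √((c² − (π+a)²)/(c² − (π−a)²))`, `κ = (1+ν)/(1−ν)`.  Then there is an odd,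
strictly increasing profile `φ` with `φ(s+N) = φ(s)+1`, satisfying
`κ tan(a(s − φ)) = tan(π φ)` on `(−N/2, N/2)`, such that `x_j(t) = j − φ(j − c t)`
is an `N`-periodic traveling-wave solution of the Calogero-Moser lattice. -/
theorem periodic_wave_CM (N : ℕ) (hN : 2 ≤ N) (c : ℝ)
    (L : ℝ) (hL : L = (N : ℝ) - 1) (a : ℝ) (ha : a = π / L)
    (hc : c > π + a)
    (ν : ℝ) (hν : ν = Real.sqrt ((c ^ 2 - (π + a) ^ 2) / (c ^ 2 - (π - a) ^ 2)))
    (κ : ℝ) (hκ : κ = (1 + ν) / (1 - ν)) :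
    ∃ φ : ℝ → ℝ, (∀ s : ℝ, φ (-s) = -φ s) ∧ StrictMono φ ∧
      (∀ s : ℝ, φ (s + (N : ℝ)) = φ s + 1) ∧
      (∀ s ∈ Set.Ioo (-(N : ℝ) / 2) ((N : ℝ) / 2),
        κ * Real.tan (a * (s - φ s)) = Real.tan (π * φ s)) ∧
      (∀ (j : ℤ) (t : ℝ),
        ((j : ℝ) + N) - φ (((j : ℝ) + N) - c * t) = ((j : ℝ) - φ ((j : ℝ) - c * t)) + L) ∧
      ∃ x' x'' : ℤ → ℝ → ℝ,
        ∀ (j : ℤ) (t : ℝ),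
          HasDerivAt (fun t' : ℝ => (j : ℝ) - φ ((j : ℝ) - c * t')) (x' j t) t ∧
          HasDerivAt (x' j) (x'' j t) t ∧
          Summable (fun k : {k : ℤ // k ≠ j} =>
            2 / (((j : ℝ) - φ ((j : ℝ) - c * t))
              - (((k : ℤ) : ℝ) - φ (((k : ℤ) : ℝ) - c * t))) ^ 3) ∧
          x'' j t = ∑' k : {k : ℤ // k ≠ j},
            2 / (((j : ℝ) - φ ((j : ℝ) - c * t))
              - (((k : ℤ) : ℝ) - φ (((k : ℤ) : ℝ) - c * t))) ^ 3 := by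
  obtain ⟨n, rfl⟩ : ∃ n, N = n + 1 := Nat.exists_eq_add_of_le' (by omega)
  have hn : 1 ≤ n := by omega
  have hn0 : (0 : ℝ) < n := by exact_mod_cast hn
  obtain rfl : L = n := by rw [hL]; push_cast; ring
  have hpi := pi_pos
  have ha0 : 0 < a := ha ▸ div_pos hpi hn0
  have hpa : π = a * n := by rw [ha]; field_simp
  have hD : 0 < c ^ 2 - (π - a) ^ 2 := by nlinarith [mul_pos hpi ha0]
  have hD' : 0 < c ^ 2 - (π + a) ^ 2 := by nlinarith
  have hν0 : 0 < ν := hν ▸ sqrt_pos.2 (div_pos hD' hD)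
  have hνsq : ν ^ 2 * (c ^ 2 - (π - a) ^ 2) = c ^ 2 - (π + a) ^ 2 := by
    rw [hν, sq_sqrt (div_pos hD' hD).le, div_mul_cancel₀ _ hD.ne']
  have hν1 : |ν| < 1 := by
    rw [← sq_lt_one_iff_abs_lt_one]
    by_contra! h
    nlinarith [mul_pos hpi ha0]
  obtain ⟨Y, hmono, hcont, hY⟩ := exists_waveAngle hν1 n
  have hφ : ∀ s, (Y s + phaseShift ν (Y s)) / π = s - Y s / a := fun s => by
    have := hY s
    rw [hpa] at this ⊢
    field_simp
    linear_combination this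
  have hY' := hasDerivAt_waveAngle hν1 hcont hY
  have hY'' := hasDerivAt_deriv_waveAngle hν1 hcont hY
  refine ⟨fun s => (Y s + phaseShift ν (Y s)) / π, fun s => ?_, fun s t hst => ?_, fun s => ?_,
    fun s hs => ?_, fun j t => ?_, fun j t => c - c / a *
      (π / (n + (1 - ν ^ 2) / (1 - 2 * ν * cos (2 * Y (j - c * t)) + ν ^ 2))), fun j t => c ^ 2 / a *
      (4 * π ^ 2 * (1 - ν ^ 2) * (ν * sin (2 * Y (j - c * t))) *
        (1 - 2 * ν * cos (2 * Y (j - c * t)) + ν ^ 2) /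
        (n * (1 - 2 * ν * cos (2 * Y (j - c * t)) + ν ^ 2) + (1 - ν ^ 2)) ^ 3), fun j t => ?_⟩
  · simp only [waveAngle_neg hν1 hY, phaseShift_neg]
    ring
  · have := strictMono_mul_add_phaseShift hν1 le_rfl (hmono hst)
    simp only [one_mul] at this
    exact div_lt_div_of_pos_right this hpi
  · push_cast
    simp only [waveAngle_add hν1 hY, phaseShift_add_pi]
    field_simp
    ring
  · simp only
    rw [mul_div_cancel₀ _ hpi.ne', tan_add_phaseShift hν1, hκ, hφ]
    congr 2
    field_simp
    ring
  · simp only [hφ]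
    push_cast
    rw [show (j : ℝ) + (n + 1) - c * t = j - c * t + (n + 1) by ring, waveAngle_add hν1 hY]
    have : π / a = n := by rw [hpa]; field_simp
    rw [add_div, this]
    ring
  simp only [hφ]
  have hlin : HasDerivAt (fun t' : ℝ => (j : ℝ) - c * t') (-c) t := by
    simpa using ((hasDerivAt_id t).const_mul c).const_sub (j : ℝ)
  have hpos : ∀ k : ℤ, (j : ℝ) - ((j : ℝ) - c * t - Y (j - c * t) / a) -
      (k - (k - c * t - Y (k - c * t) / a)) =
      (Y (j - c * t) - Y (j - c * t + (k - j : ℤ))) / a := fun k => by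
    push_cast
    rw [show (j : ℝ) - c * t + (k - j) = k - c * t by ring]
    ring
  have hsum : HasSum (fun k : {k : ℤ // k ≠ j} => 2 / ((j : ℝ) -
      ((j : ℝ) - c * t - Y (j - c * t) / a) - ((k : ℤ) - ((k : ℤ) - c * t -
        Y ((k : ℤ) - c * t) / a))) ^ 3) (c ^ 2 / a *
      (4 * π ^ 2 * (1 - ν ^ 2) * (ν * sin (2 * Y (j - c * t))) *
        (1 - 2 * ν * cos (2 * Y (j - c * t)) + ν ^ 2) /
        (n * (1 - 2 * ν * cos (2 * Y (j - c * t)) + ν ^ 2) + (1 - ν ^ 2)) ^ 3)) := by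
    have h1 := (hasSum_force_waveAngle hν1 hn hmono hY (j - c * t)).mul_left (a ^ 3)
    rw [← (Equiv.subRight j).hasSum_iff] at h1
    rw [← Function.Injective.hasSum_iff (g := ((↑) : {k : ℤ // k ≠ j} → ℤ))
      Subtype.val_injective (fun k hk => by
        have : k = j := by simpa using hk
        simp [this])] at h1
    convert! h1 using 1
    · ext k
      simp only [hpos, Function.comp, Equiv.subRight_apply]
      rw [div_pow, div_div_eq_mul_div]
      ring
    · have hc2 : c ^ 2 * (1 - ν ^ 2) = a ^ 2 * ((n + 1) ^ 2 - (n - 1) ^ 2 * ν ^ 2) := by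
        rw [hpa] at hνsq
        linear_combination -hνsq
      rw [← mul_div_assoc, ← mul_div_assoc]
      congr 1
      rw [div_mul_eq_mul_div, div_eq_iff ha0.ne', hpa]
      linear_combination (4 * a ^ 2 * n ^ 2 * (ν * sin (2 * Y (j - c * t))) *
        (1 - 2 * ν * cos (2 * Y (j - c * t)) + ν ^ 2)) * hc2
  refine ⟨?_, ?_, hsum.summable, hsum.tsum_eq.symm⟩
  · convert! ((hlin.sub (((hY' _).comp t hlin).div_const a)).const_sub (j : ℝ)) using 1
    ring
  · convert! (((hY'' _).comp t hlin).const_mul (c / a)).const_sub c using 1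
    ring
end

section
/- Let α > 3 and let v: ℝ² → ℝ be smooth with square-integrable x-derivatives ∂_x^n v for 1 ≤ n ≤ 5 (square-integrable in x, uniformly in the second argument τ, with all these derivatives bounded and continuous). Set u = −∂_x v, κ₁ = 2c_α, κ₂ = α(α+1)(α+2)ζ(α), κ₃ = (1/12)α(α+1)ζ(α−2), and let Q(x,τ) = κ₁·∂_τ u + κ₂·u·∂_x u + κ₃·∂_x³ u evaluated at (x,τ). Then for the KdV scaling exponents p = 1, q = 3, the lattice error satisfies R_ε(x,τ) = ε⁵·Q(x,τ) + o(ε⁵) as ε → 0⁺, for each fixed (x,τ) ∈ ℝ². -/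
open Real Filter Topology MeasureTheory

/-- The Riemann zeta function `ζ(α) = Σ_{m=1}^∞ m^{-α}` for real `α > 1`. -/
noncomputable def zetaR (α : ℝ) : ℝ := ∑' m : ℕ, ((m : ℝ) + 1) ^ (-α)

/-- The sonic speed `c_α = √(α(α+1)ζ(α))`. -/
noncomputable def sonicSpeed (α : ℝ) : ℝ := Real.sqrt (α * (α + 1) * zetaR α)

/-- The long-wave ansatz `X_ε(j,t) = j + ε^p v(ε(j − c_α t), ε^q t)`. -/
noncomputable def ansatz (α p q : ℝ) (v : ℝ → ℝ → ℝ) (ε j t : ℝ) : ℝ :=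
  j + ε ^ p * v (ε * (j - sonicSpeed α * t)) (ε ^ q * t)

/-- The lattice error `R_ε(x,τ)` of the long-wave ansatz in the infinite lattice
with power-law forces `F ∼ r^{-α-1}`. -/
noncomputable def latticeError (α p q : ℝ) (v : ℝ → ℝ → ℝ) (ε x τ : ℝ) : ℝ :=
  let t := τ / ε ^ q
  let j := x / ε + sonicSpeed α * t
  iteratedDeriv 2 (fun t' => ansatz α p q v ε j t') t
    + α * ∑' m : ℕ+, ((ansatz α p q v ε (j + (m : ℝ)) t - ansatz α p q v ε j t) ^ (-(α + 1))
        - (ansatz α p q v ε j t - ansatz α p q v ε (j - (m : ℝ)) t) ^ (-(α + 1)))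

/-- A function vanishing at `0` whose derivative is `O(y ^ n)` is `O(y ^ (n + 1))`. -/
theorem abs_le_mul_pow_succ_of_hasDerivAt {g g' : ℝ → ℝ} {r B : ℝ} {n : ℕ} (hB : 0 ≤ B)
    (hg : ∀ y, |y| ≤ r → HasDerivAt g (g' y) y) (hg0 : g 0 = 0)
    (hb : ∀ y, |y| ≤ r → |g' y| ≤ B * |y| ^ n) {h : ℝ} (hh : |h| ≤ r) :
    |g h| ≤ B * |h| ^ (n + 1) := by
  have hball : ∀ y ∈ Metric.closedBall (0 : ℝ) |h|, |y| ≤ |h| := fun y hy => by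
    simpa using hy
  have key := (convex_closedBall (0 : ℝ) |h|).norm_image_sub_le_of_norm_hasDerivWithin_le
    (f := g) (f' := g') (C := B * |h| ^ n) (x := 0) (y := h)
    (fun y hy => (hg y ((hball y hy).trans hh)).hasDerivWithinAt)
    (fun y hy => (hb y ((hball y hy).trans hh)).trans (by
      have := hball y hy
      gcongr))
    (by simp) (by simp)
  simpa [hg0, pow_succ, mul_assoc] using key

/-- Taylor's formula with a uniform bound on the remainder, on both sides of the base point. -/
theorem abs_sub_taylor_sum_le {B : ℝ} (hB : 0 ≤ B) (n : ℕ) :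
    ∀ f : ℝ → ℝ, ContDiff ℝ (⊤ : ℕ∞) f → (∀ y, |iteratedDeriv (n + 1) f y| ≤ B) →
      ∀ x h : ℝ, |f (x + h) - ∑ k ∈ Finset.range (n + 1),
        iteratedDeriv k f x * h ^ k / (k.factorial : ℝ)| ≤ B * |h| ^ (n + 1) := by
  induction n with
  | zero =>
    intro f hf hb x h
    refine abs_le_mul_pow_succ_of_hasDerivAt (r := |h|) (n := 0) hB
      (g := fun h => f (x + h) - ∑ k ∈ Finset.range (0 + 1),
        iteratedDeriv k f x * h ^ k / (k.factorial : ℝ))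
      (g' := fun h => deriv f (x + h)) (fun y _ => ?_) (by simp) (fun y _ => ?_) le_rfl
    · have h1 := (hf.differentiable (by simp) (x + y)).hasDerivAt.comp_const_add x y
      simpa using h1.sub_const (f x)
    · simpa using hb (x + y)
  | succ n ih =>
    intro f hf hb x h
    have hf' : ContDiff ℝ (⊤ : ℕ∞) (deriv f) := by
      have := (contDiff_infty_iff_deriv (𝕜 := ℝ) (f := f)).1 hf
      exact this.2
    refine abs_le_mul_pow_succ_of_hasDerivAt (r := |h|) (n := n + 1) hB
      (g := fun h => f (x + h) - ∑ k ∈ Finset.range (n + 1 + 1),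
        iteratedDeriv k f x * h ^ k / (k.factorial : ℝ))
      (g' := fun h => deriv f (x + h) - ∑ k ∈ Finset.range (n + 1),
        iteratedDeriv k (deriv f) x * h ^ k / (k.factorial : ℝ))
      (fun y _ => ?_) ?_ (fun y _ => ?_) le_rfl
    · have h1 := (hf.differentiable (by simp) (x + y)).hasDerivAt.comp_const_add x y
      refine h1.sub ?_
      simp_rw [Finset.sum_range_succ' _ (n + 1)]
      simp only [pow_zero, mul_one, Nat.factorial_zero, Nat.cast_one, div_one]
      refine HasDerivAt.add_const _ (HasDerivAt.fun_sum fun k _ => ?_)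
      have h2 := (((hasDerivAt_id y).pow (k + 1)).const_mul
        (iteratedDeriv (k + 1) f x)).div_const ((k + 1).factorial : ℝ)
      refine h2.congr_deriv ?_
      rw [iteratedDeriv_succ', Nat.factorial_succ]
      have : (k.factorial : ℝ) ≠ 0 := by positivity
      have : (k : ℝ) + 1 ≠ 0 := by positivity
      push_cast
      simp only [id, mul_one]
      field_simp
    · simp [Finset.sum_range_succ' _ (n + 1)]
    · exact ih (deriv f) hf' (fun z => by simpa [iteratedDeriv_succ'] using hb z) x y

theorem hasDerivAt_one_add_rpow_neg {s y : ℝ} (hy : |y| ≤ 1 / 2) :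
    HasDerivAt (fun y : ℝ => (1 + y) ^ (-s)) (-s * (1 + y) ^ (-(s + 1))) y := by
  have hpos : 0 < 1 + y := by linarith [(abs_le.1 hy).1]
  have h := ((hasDerivAt_id y).const_add 1).rpow_const (p := -s) (Or.inl hpos.ne')
  refine h.congr_deriv ?_
  simp only [id]
  rw [show -s - 1 = -(s + 1) by ring]
  ring

theorem abs_one_add_rpow_neg_sub_le {s : ℝ} (hs : 0 < s) {y : ℝ} (hy : |y| ≤ 1 / 2) :
    |(1 + y) ^ (-s) - 1| ≤ s * 2 ^ (s + 1) * |y| := by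
  have := abs_le_mul_pow_succ_of_hasDerivAt (r := 1 / 2) (n := 0) (B := s * 2 ^ (s + 1))
    (by positivity) (g := fun y : ℝ => (1 + y) ^ (-s) - 1)
    (g' := fun y => -s * (1 + y) ^ (-(s + 1)))
    (fun y hy => (hasDerivAt_one_add_rpow_neg hy).sub_const 1) (by simp) (fun y hy => ?_) hy
  · simpa using this
  · have hlow : 1 / 2 ≤ 1 + y := by linarith [(abs_le.1 hy).1]
    have hle : (1 + y) ^ (-(s + 1)) ≤ 2 ^ (s + 1) := by
      calc (1 + y) ^ (-(s + 1)) ≤ (1 / 2 : ℝ) ^ (-(s + 1)) :=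
            Real.rpow_le_rpow_of_nonpos (by norm_num) hlow (by linarith)
        _ = 2 ^ (s + 1) := by
            rw [one_div, Real.inv_rpow (by norm_num), Real.rpow_neg (by norm_num), inv_inv]
    rw [abs_mul, abs_neg, abs_of_pos hs, abs_of_nonneg (by positivity)]
    simpa using mul_le_mul_of_nonneg_left hle hs.le

theorem abs_one_add_rpow_neg_sub_linear_le {s : ℝ} (hs : 0 < s) {y : ℝ} (hy : |y| ≤ 1 / 2) :
    |(1 + y) ^ (-s) - 1 + s * y| ≤ s * ((s + 1) * 2 ^ (s + 1 + 1)) * |y| ^ 2 := by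
  refine abs_le_mul_pow_succ_of_hasDerivAt (r := 1 / 2) (n := 1)
    (by positivity) (g := fun y : ℝ => (1 + y) ^ (-s) - 1 + s * y)
    (g' := fun y => -s * (1 + y) ^ (-(s + 1)) + s)
    (fun y hy => ?_) (by simp) (fun y hy => ?_) hy
  · simpa using ((hasDerivAt_one_add_rpow_neg hy).sub_const 1).fun_add
      ((hasDerivAt_id y).const_mul s)
  · have h := abs_one_add_rpow_neg_sub_le (s := s + 1) (by linarith) hy
    rw [show -s * (1 + y) ^ (-(s + 1)) + s = -(s * ((1 + y) ^ (-(s + 1)) - 1)) by ring,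
      abs_neg, abs_mul, abs_of_pos hs, pow_one, mul_assoc]
    exact mul_le_mul_of_nonneg_left h hs.le

/-- Second-order expansion of differences of `(1 + y) ^ (-s)` near `0`. -/
theorem exists_abs_one_add_rpow_neg_diff_le {s : ℝ} (hs : 0 < s) :
    ∃ C : ℝ, 0 ≤ C ∧ ∀ M a b : ℝ, M ≤ 1 / 2 → |a| ≤ M → |b| ≤ M →
      |(1 + a) ^ (-s) - (1 + b) ^ (-s) + s * (a - b) - s * (s + 1) / 2 * (a ^ 2 - b ^ 2)|
        ≤ C * M ^ 2 * |a - b| := by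
  refine ⟨s * ((s + 1) * ((s + 1 + 1) * 2 ^ (s + 1 + 1 + 1))), by positivity,
    fun M a b hM ha hb => ?_⟩
  have hball : ∀ y ∈ Metric.closedBall (0 : ℝ) M, |y| ≤ M := fun y hy => by simpa using hy
  have key := (convex_closedBall (0 : ℝ) M).norm_image_sub_le_of_norm_hasDerivWithin_le
    (f := fun y : ℝ => (1 + y) ^ (-s) + s * y - s * (s + 1) / 2 * y ^ 2)
    (f' := fun y => -s * ((1 + y) ^ (-(s + 1)) - 1 + (s + 1) * y))
    (C := s * ((s + 1) * ((s + 1 + 1) * 2 ^ (s + 1 + 1 + 1))) * M ^ 2) (x := b) (y := a)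
    (fun y hy => ?_) (fun y hy => ?_) (by simpa using hb) (by simpa using ha)
  · simp only [Real.norm_eq_abs] at key
    refine le_trans (le_of_eq ?_) key
    congr 1
    ring
  · have hy' := (hball y hy).trans hM
    have h := ((hasDerivAt_one_add_rpow_neg (s := s) hy').fun_add
      ((hasDerivAt_id y).const_mul s)).fun_sub
      (((hasDerivAt_id y).pow 2).const_mul (s * (s + 1) / 2))
    refine (h.congr_deriv ?_).hasDerivWithinAt
    simp
    ring
  · have hy' := hball y hy
    have h := abs_one_add_rpow_neg_sub_linear_le (s := s + 1) (by linarith) (hy'.trans hM)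
    rw [Real.norm_eq_abs, abs_mul, abs_neg, abs_of_pos hs, mul_assoc]
    refine mul_le_mul_of_nonneg_left (h.trans ?_) hs.le
    gcongr

theorem hasSum_zetaR {s : ℝ} (hs : 1 < s) :
    HasSum (fun m : ℕ+ => (m : ℝ) ^ (-s)) (zetaR s) := by
  have h1 : Summable (fun m : ℕ => ((m : ℝ) + 1) ^ (-s)) := by
    have h := (summable_nat_add_iff (f := fun m : ℕ => (m : ℝ) ^ (-s)) 1).2
      (Real.summable_nat_rpow.2 (by linarith))
    simpa using h
  rw [← Equiv.pnatEquivNat.symm.hasSum_iff]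
  have h2 : HasSum (fun m : ℕ => ((m : ℝ) + 1) ^ (-s)) (zetaR s) := h1.hasSum
  convert h2 using 2 with m
  simp

/-- A function with limit `l` at `0⁺` (at a linear rate) converges to `l` along `h = ε m`, `ε → 0⁺`. -/
theorem tendsto_of_abs_sub_le {g : ℝ → ℝ} {l C : ℝ}
    (hg : ∀ h : ℝ, 0 < h → |g h - l| ≤ C * h) (m : ℕ+) :
    Tendsto (fun ε : ℝ => g (ε * (m : ℝ))) (𝓝[>] 0) (𝓝 l) := by
  have hm : (0 : ℝ) < m := by exact_mod_cast m.pos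
  rw [tendsto_iff_norm_sub_tendsto_zero]
  have hlim : Tendsto (fun ε : ℝ => C * (ε * (m : ℝ))) (𝓝[>] 0) (𝓝 0) := by
    have : Continuous fun ε : ℝ => C * (ε * (m : ℝ)) := by fun_prop
    simpa using (this.tendsto 0).mono_left nhdsWithin_le_nhds
  refine squeeze_zero' (Eventually.of_forall fun _ => norm_nonneg _) ?_ hlim
  filter_upwards [self_mem_nhdsWithin] with ε hε
  exact hg _ (mul_pos hε hm)

theorem abs_forward_quotient_le {f : ℝ → ℝ} {B : ℝ} (hB : 0 ≤ B)
    (hf : ContDiff ℝ (⊤ : ℕ∞) f)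
    (hb : ∀ n : ℕ, 1 ≤ n → n ≤ 5 → ∀ y, |iteratedDeriv n f y| ≤ B) (x : ℝ)
    {h : ℝ} (hh : 0 < h) : |(f (x + h) - f x) / h| ≤ B := by
  have h1 := abs_sub_taylor_sum_le hB 0 f hf (hb 1 (by norm_num) (by norm_num)) x h
  simp only [zero_add, Finset.sum_range_one, iteratedDeriv_zero, pow_zero, mul_one,
    Nat.factorial_zero, Nat.cast_one, div_one, pow_one, abs_of_pos hh] at h1
  rw [abs_div, abs_of_pos hh, div_le_iff₀ hh]
  exact h1

theorem abs_backward_quotient_le {f : ℝ → ℝ} {B : ℝ} (hB : 0 ≤ B)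
    (hf : ContDiff ℝ (⊤ : ℕ∞) f)
    (hb : ∀ n : ℕ, 1 ≤ n → n ≤ 5 → ∀ y, |iteratedDeriv n f y| ≤ B) (x : ℝ)
    {h : ℝ} (hh : 0 < h) : |(f x - f (x - h)) / h| ≤ B := by
  simpa using abs_forward_quotient_le hB hf hb (x - h) hh

theorem abs_forward_quotient_sub_le {f : ℝ → ℝ} {B : ℝ} (hB : 0 ≤ B)
    (hf : ContDiff ℝ (⊤ : ℕ∞) f)
    (hb : ∀ n : ℕ, 1 ≤ n → n ≤ 5 → ∀ y, |iteratedDeriv n f y| ≤ B) (x : ℝ)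
    {h : ℝ} (hh : 0 < h) :
    |(f (x + h) - f x) / h - iteratedDeriv 1 f x| ≤ B * h := by
  have h1 := abs_sub_taylor_sum_le hB 1 f hf (hb 2 (by norm_num) (by norm_num)) x h
  simp only [Finset.sum_range_succ, Finset.sum_range_zero] at h1
  norm_num [abs_of_pos hh] at h1
  rw [show (f (x + h) - f x) / h - iteratedDeriv 1 f x
      = (f (x + h) - (f x + deriv f x * h)) / h by rw [iteratedDeriv_one]; field_simp; ring,
    abs_div, abs_of_pos hh, div_le_iff₀ hh]
  linarith

theorem abs_backward_quotient_sub_le {f : ℝ → ℝ} {B : ℝ} (hB : 0 ≤ B)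
    (hf : ContDiff ℝ (⊤ : ℕ∞) f)
    (hb : ∀ n : ℕ, 1 ≤ n → n ≤ 5 → ∀ y, |iteratedDeriv n f y| ≤ B) (x : ℝ)
    {h : ℝ} (hh : 0 < h) :
    |(f x - f (x - h)) / h - iteratedDeriv 1 f x| ≤ B * h := by
  have h1 := abs_sub_taylor_sum_le hB 1 f hf (hb 2 (by norm_num) (by norm_num)) x (-h)
  simp only [Finset.sum_range_succ, Finset.sum_range_zero] at h1
  norm_num [abs_of_pos hh, ← sub_eq_add_neg] at h1
  rw [show (f x - f (x - h)) / h - iteratedDeriv 1 f x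
      = -(f (x - h) - (f x - deriv f x * h)) / h by rw [iteratedDeriv_one]; field_simp; ring,
    abs_div, abs_neg, abs_of_pos hh, div_le_iff₀ hh]
  linarith

theorem abs_second_quotient_le {f : ℝ → ℝ} {B : ℝ} (hB : 0 ≤ B)
    (hf : ContDiff ℝ (⊤ : ℕ∞) f)
    (hb : ∀ n : ℕ, 1 ≤ n → n ≤ 5 → ∀ y, |iteratedDeriv n f y| ≤ B) (x : ℝ)
    {h : ℝ} (hh : 0 < h) :
    |(f (x + h) - 2 * f x + f (x - h)) / h ^ 2| ≤ 2 * B := by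
  have h1 := abs_sub_taylor_sum_le hB 1 f hf (hb 2 (by norm_num) (by norm_num)) x h
  have h2 := abs_sub_taylor_sum_le hB 1 f hf (hb 2 (by norm_num) (by norm_num)) x (-h)
  simp only [Finset.sum_range_succ, Finset.sum_range_zero] at h1 h2
  norm_num [abs_of_pos hh, ← sub_eq_add_neg] at h1 h2
  rw [abs_div, abs_of_pos (pow_pos hh 2), div_le_iff₀ (pow_pos hh 2)]
  rw [abs_le] at *
  constructor <;> linarith

theorem abs_second_quotient_sub_le {f : ℝ → ℝ} {B : ℝ} (hB : 0 ≤ B)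
    (hf : ContDiff ℝ (⊤ : ℕ∞) f)
    (hb : ∀ n : ℕ, 1 ≤ n → n ≤ 5 → ∀ y, |iteratedDeriv n f y| ≤ B) (x : ℝ)
    {h : ℝ} (hh : 0 < h) :
    |(f (x + h) - 2 * f x + f (x - h)) / h ^ 2 - iteratedDeriv 2 f x| ≤ 2 * B * h := by
  have h1 := abs_sub_taylor_sum_le hB 2 f hf (hb 3 (by norm_num) (by norm_num)) x h
  have h2 := abs_sub_taylor_sum_le hB 2 f hf (hb 3 (by norm_num) (by norm_num)) x (-h)
  simp only [Finset.sum_range_succ, Finset.sum_range_zero] at h1 h2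
  norm_num [abs_of_pos hh, Nat.factorial, ← sub_eq_add_neg] at h1 h2
  rw [show (f (x + h) - 2 * f x + f (x - h)) / h ^ 2 - iteratedDeriv 2 f x
      = (f (x + h) - 2 * f x + f (x - h) - iteratedDeriv 2 f x * h ^ 2) / h ^ 2 by field_simp,
    abs_div, abs_of_pos (pow_pos hh 2), div_le_iff₀ (pow_pos hh 2)]
  rw [abs_le] at *
  constructor <;> linarith

theorem abs_fourth_quotient_le {f : ℝ → ℝ} {B : ℝ} (hB : 0 ≤ B)
    (hf : ContDiff ℝ (⊤ : ℕ∞) f)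
    (hb : ∀ n : ℕ, 1 ≤ n → n ≤ 5 → ∀ y, |iteratedDeriv n f y| ≤ B) (x : ℝ)
    {h : ℝ} (hh : 0 < h) :
    |(f (x + h) - 2 * f x + f (x - h) - h ^ 2 * iteratedDeriv 2 f x) / h ^ 4| ≤ 2 * B := by
  have h1 := abs_sub_taylor_sum_le hB 3 f hf (hb 4 (by norm_num) (by norm_num)) x h
  have h2 := abs_sub_taylor_sum_le hB 3 f hf (hb 4 (by norm_num) (by norm_num)) x (-h)
  simp only [Finset.sum_range_succ, Finset.sum_range_zero] at h1 h2
  norm_num [abs_of_pos hh, Nat.factorial, ← sub_eq_add_neg, Odd.neg_pow (show Odd 3 by decide)]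
    at h1 h2
  rw [abs_div, abs_of_pos (pow_pos hh 4), div_le_iff₀ (pow_pos hh 4)]
  rw [abs_le] at *
  ring_nf at *
  constructor <;> linarith

theorem abs_fourth_quotient_sub_le {f : ℝ → ℝ} {B : ℝ} (hB : 0 ≤ B)
    (hf : ContDiff ℝ (⊤ : ℕ∞) f)
    (hb : ∀ n : ℕ, 1 ≤ n → n ≤ 5 → ∀ y, |iteratedDeriv n f y| ≤ B) (x : ℝ)
    {h : ℝ} (hh : 0 < h) :
    |(f (x + h) - 2 * f x + f (x - h) - h ^ 2 * iteratedDeriv 2 f x) / h ^ 4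
      - iteratedDeriv 4 f x / 12| ≤ 2 * B * h := by
  have h1 := abs_sub_taylor_sum_le hB 4 f hf (hb 5 (by norm_num) (by norm_num)) x h
  have h2 := abs_sub_taylor_sum_le hB 4 f hf (hb 5 (by norm_num) (by norm_num)) x (-h)
  simp only [Finset.sum_range_succ, Finset.sum_range_zero] at h1 h2
  norm_num [abs_of_pos hh, Nat.factorial, ← sub_eq_add_neg, Odd.neg_pow (show Odd 3 by decide),
    Even.neg_pow (show Even 4 by decide)] at h1 h2
  rw [show (f (x + h) - 2 * f x + f (x - h) - h ^ 2 * iteratedDeriv 2 f x) / h ^ 4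
      - iteratedDeriv 4 f x / 12 = (f (x + h) - 2 * f x + f (x - h)
        - h ^ 2 * iteratedDeriv 2 f x - iteratedDeriv 4 f x / 12 * h ^ 4) / h ^ 4 by field_simp,
    abs_div, abs_of_pos (pow_pos hh 4), div_le_iff₀ (pow_pos hh 4)]
  rw [abs_le] at *
  ring_nf at *
  constructor <;> linarith

/-- The net force exerted by the two neighbours at distance `m` when the displacement field is
`ε f(ε ·)` and the pair force is `r ↦ r ^ (-s)`. -/
noncomputable def pairForce (s : ℝ) (f : ℝ → ℝ) (x ε m : ℝ) : ℝ :=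
  (m + ε * (f (x + ε * m) - f x)) ^ (-s) - (m + ε * (f x - f (x - ε * m))) ^ (-s)

/-- The coefficient of `ε ^ 5` in the expansion of `pairForce`. -/
noncomputable def pairForceCoeff (s : ℝ) (f : ℝ → ℝ) (x h m : ℝ) : ℝ :=
  m ^ (-s) * (-s * m ^ 3 *
      ((f (x + h) - 2 * f x + f (x - h) - h ^ 2 * iteratedDeriv 2 f x) / h ^ 4)
    + s * (s + 1) / 2 * m * ((f (x + h) - 2 * f x + f (x - h)) / h ^ 2)
      * ((f (x + h) - f x) / h + (f x - f (x - h)) / h))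

theorem exists_abs_pairForce_sub_le {s : ℝ} (hs : 0 < s) {f : ℝ → ℝ} {B : ℝ} (hB : 0 ≤ B)
    (hf : ContDiff ℝ (⊤ : ℕ∞) f)
    (hb : ∀ n : ℕ, 1 ≤ n → n ≤ 5 → ∀ y, |iteratedDeriv n f y| ≤ B) (x : ℝ) :
    ∃ C : ℝ, 0 ≤ C ∧ ∀ ε m : ℝ, 0 < ε → ε ^ 2 * B ≤ 1 / 2 → 0 < m →
      |(pairForce s f x ε m + s * m ^ (-(s - 1)) * ε ^ 3 * iteratedDeriv 2 f x) / ε ^ 5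
        - pairForceCoeff s f x (ε * m) m| ≤ m ^ (-s) * (C * ε ^ 2 * m) := by
  obtain ⟨C, hC, hexp⟩ := exists_abs_one_add_rpow_neg_diff_le hs
  refine ⟨C * B ^ 2 * (2 * B), by positivity, fun ε m hε hεB hm => ?_⟩
  have hh : 0 < ε * m := mul_pos hε hm
  have hP := abs_forward_quotient_le hB hf hb x hh
  have hN := abs_backward_quotient_le hB hf hb x hh
  have hE := abs_second_quotient_le hB hf hb x hh
  unfold pairForce pairForceCoeff
  generalize hPd : (f (x + ε * m) - f x) / (ε * m) = P at *
  generalize hNd : (f x - f (x - ε * m)) / (ε * m) = N at *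
  generalize hEd : (f (x + ε * m) - 2 * f x + f (x - ε * m)) / (ε * m) ^ 2 = E at *
  generalize iteratedDeriv 2 f x = d
  have hP' : f (x + ε * m) - f x = ε * m * P := by rw [← hPd]; field_simp
  have hN' : f x - f (x - ε * m) = ε * m * N := by rw [← hNd]; field_simp
  have hE' : f (x + ε * m) - 2 * f x + f (x - ε * m) = (ε * m) ^ 2 * E := by
    rw [← hEd]; field_simp
  have hPN : P - N = ε * m * E := by
    have : ε * m * (P - N) = ε * m * (ε * m * E) := by
      rw [mul_sub, ← hP', ← hN']; linarith
    exact mul_left_cancel₀ hh.ne' this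
  have ha : |ε ^ 2 * P| ≤ ε ^ 2 * B := by
    rw [abs_mul, abs_of_pos (by positivity)]; gcongr
  have hb' : |ε ^ 2 * N| ≤ ε ^ 2 * B := by
    rw [abs_mul, abs_of_pos (by positivity)]; gcongr
  have hsplit : ∀ y, |ε ^ 2 * y| ≤ ε ^ 2 * B →
      (m + ε * (ε * m * y)) ^ (-s) = m ^ (-s) * (1 + ε ^ 2 * y) ^ (-s) := fun y hy => by
    rw [← Real.mul_rpow hm.le (by linarith [(abs_le.1 hy).1])]
    ring_nf
  have hpow : m ^ (-(s - 1)) = m ^ (-s) * m := by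
    rw [show -(s - 1) = -s + 1 by ring, Real.rpow_add_one hm.ne']
  have hrem := hexp _ _ _ hεB ha hb'
  rw [hP', hN', hE', hsplit P ha, hsplit N hb', hpow]
  generalize (1 + ε ^ 2 * P) ^ (-s) = p at *
  generalize (1 + ε ^ 2 * N) ^ (-s) = q at *
  have hdiff : ε ^ 2 * P - ε ^ 2 * N = ε ^ 3 * m * E := by
    rw [← mul_sub, hPN]; ring
  have hw : 0 ≤ m ^ (-s) := by positivity
  have hkey : (m ^ (-s) * p - m ^ (-s) * q + s * (m ^ (-s) * m) * ε ^ 3 * d) / ε ^ 5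
      - m ^ (-s) * (-s * m ^ 3 * (((ε * m) ^ 2 * E - (ε * m) ^ 2 * d) / (ε * m) ^ 4)
        + s * (s + 1) / 2 * m * E * (P + N))
      = m ^ (-s) * ((p - q + s * (ε ^ 2 * P - ε ^ 2 * N)
        - s * (s + 1) / 2 * ((ε ^ 2 * P) ^ 2 - (ε ^ 2 * N) ^ 2)) / ε ^ 5) := by
    rw [sq_sub_sq, hdiff]
    field_simp
    ring
  rw [hkey, abs_mul, abs_of_nonneg hw, abs_div, abs_of_pos (pow_pos hε 5)]
  refine mul_le_mul_of_nonneg_left ((div_le_iff₀ (pow_pos hε 5)).2 (hrem.trans ?_)) hw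
  rw [hdiff, abs_mul, abs_of_pos (by positivity : 0 < ε ^ 3 * m)]
  calc C * (ε ^ 2 * B) ^ 2 * (ε ^ 3 * m * |E|)
      ≤ C * (ε ^ 2 * B) ^ 2 * (ε ^ 3 * m * (2 * B)) := by gcongr
    _ = C * B ^ 2 * (2 * B) * ε ^ 2 * m * ε ^ 5 := by ring

theorem abs_pairForceCoeff_le {s : ℝ} (hs : 0 < s) {f : ℝ → ℝ} {B : ℝ} (hB : 0 ≤ B)
    (hf : ContDiff ℝ (⊤ : ℕ∞) f)
    (hb : ∀ n : ℕ, 1 ≤ n → n ≤ 5 → ∀ y, |iteratedDeriv n f y| ≤ B) (x : ℝ) {h m : ℝ}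
    (hh : 0 < h) (hm : 0 < m) :
    |pairForceCoeff s f x h m| ≤
      m ^ (-s) * (s * m ^ 3 * (2 * B) + s * (s + 1) / 2 * m * (2 * B) * (B + B)) := by
  have hP := abs_forward_quotient_le hB hf hb x hh
  have hN := abs_backward_quotient_le hB hf hb x hh
  have hE := abs_second_quotient_le hB hf hb x hh
  have hA := abs_fourth_quotient_le hB hf hb x hh
  unfold pairForceCoeff
  rw [abs_mul, abs_of_nonneg (by positivity : 0 ≤ m ^ (-s))]
  gcongr
  refine (abs_add_le _ _).trans (add_le_add ?_ ?_)
  · rw [abs_mul, abs_mul, abs_neg, abs_of_pos hs, abs_of_pos (pow_pos hm 3)]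
    gcongr
  · rw [abs_mul, abs_mul, abs_of_pos (by positivity : 0 < s * (s + 1) / 2 * m)]
    gcongr
    exact (abs_add_le _ _).trans (add_le_add hP hN)

theorem tendsto_pairForceCoeff (s : ℝ) {f : ℝ → ℝ} {B : ℝ} (hB : 0 ≤ B)
    (hf : ContDiff ℝ (⊤ : ℕ∞) f)
    (hb : ∀ n : ℕ, 1 ≤ n → n ≤ 5 → ∀ y, |iteratedDeriv n f y| ≤ B) (x : ℝ) (m : ℕ+) :
    Tendsto (fun ε : ℝ => pairForceCoeff s f x (ε * (m : ℝ)) m) (𝓝[>] 0)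
      (𝓝 ((m : ℝ) ^ (-s) * (-s * (m : ℝ) ^ 3 * (iteratedDeriv 4 f x / 12)
        + s * (s + 1) / 2 * m * iteratedDeriv 2 f x
          * (iteratedDeriv 1 f x + iteratedDeriv 1 f x)))) := by
  have hP := tendsto_of_abs_sub_le (fun h hh => abs_forward_quotient_sub_le hB hf hb x hh) m
  have hN := tendsto_of_abs_sub_le (fun h hh => abs_backward_quotient_sub_le hB hf hb x hh) m
  have hE := tendsto_of_abs_sub_le (fun h hh => abs_second_quotient_sub_le hB hf hb x hh) m
  have hA := tendsto_of_abs_sub_le (fun h hh => abs_fourth_quotient_sub_le hB hf hb x hh) m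
  exact ((hA.const_mul _).add ((hE.const_mul _).mul (hP.add hN))).const_mul _

/-- Expansion up to order `ε ^ 5` of the total force of a power-law lattice. -/
theorem tendsto_tsum_pairForce {α : ℝ} (hα : 3 < α) {f : ℝ → ℝ} {B : ℝ} (hB : 0 ≤ B)
    (hf : ContDiff ℝ (⊤ : ℕ∞) f)
    (hb : ∀ n : ℕ, 1 ≤ n → n ≤ 5 → ∀ y, |iteratedDeriv n f y| ≤ B) (x : ℝ) :
    Tendsto (fun ε : ℝ => ((∑' m : ℕ+, pairForce (α + 1) f x ε m)
        + (α + 1) * zetaR α * ε ^ 3 * iteratedDeriv 2 f x) / ε ^ 5) (𝓝[>] 0)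
      (𝓝 (-(α + 1) * zetaR (α - 2) * (iteratedDeriv 4 f x / 12)
        + (α + 1) * (α + 2) * zetaR α * iteratedDeriv 1 f x * iteratedDeriv 2 f x)) := by
  have hs : 0 < α + 1 := by linarith
  obtain ⟨C, hC, hexp⟩ := exists_abs_pairForce_sub_le hs hB hf hb x
  have hζ := hasSum_zetaR (s := α) (by linarith)
  have hζ2 := hasSum_zetaR (s := α - 2) (by linarith)
  have hmpos : ∀ m : ℕ+, (0 : ℝ) < m := fun m => by exact_mod_cast m.pos
  have hpow1 : ∀ m : ℕ+, (m : ℝ) ^ (-(α + 1)) * m = (m : ℝ) ^ (-α) := fun m => by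
    rw [← Real.rpow_add_one (hmpos m).ne']; ring_nf
  have hpow3 : ∀ m : ℕ+, (m : ℝ) ^ (-(α + 1)) * (m : ℝ) ^ 3 = (m : ℝ) ^ (-(α - 2)) := fun m => by
    rw [← Real.rpow_natCast, ← Real.rpow_add (hmpos m)]; push_cast; ring_nf
  let T : ℝ → ℕ+ → ℝ := fun ε m =>
    (pairForce (α + 1) f x ε m + (α + 1) * (m : ℝ) ^ (-α) * ε ^ 3 * iteratedDeriv 2 f x) / ε ^ 5
  have hT : ∀ ε : ℝ, 0 < ε → ε ^ 2 * B ≤ 1 / 2 → ∀ m : ℕ+,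
      |T ε m - pairForceCoeff (α + 1) f x (ε * m) m|
        ≤ (m : ℝ) ^ (-(α + 1)) * (C * ε ^ 2 * m) := fun ε hε hεB m => by
    have := hexp ε m hε hεB (hmpos m)
    rwa [add_sub_cancel_right] at this
  let K : ℝ := (α + 1) * (2 * B) + (α + 1) * (α + 1 + 1) / 2 * (2 * B) * (B + B) + C
  have hbound : ∀ ε : ℝ, 0 < ε → ε ≤ 1 → ε ^ 2 * B ≤ 1 / 2 → ∀ m : ℕ+,
      |T ε m| ≤ K * (m : ℝ) ^ (-(α - 2)) := fun ε hε hε1 hεB m => by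
    have h1 := hT ε hε hεB m
    have h2 := abs_pairForceCoeff_le hs hB hf hb x (mul_pos hε (hmpos m)) (hmpos m)
    have hm1 : (1 : ℝ) ≤ m := by exact_mod_cast one_le (a := m)
    have hm3 : (m : ℝ) ≤ (m : ℝ) ^ 3 := le_self_pow₀ hm1 (by norm_num)
    have hε2 : ε ^ 2 ≤ 1 := pow_le_one₀ hε.le hε1
    have h3 : |T ε m| ≤ |T ε m - pairForceCoeff (α + 1) f x (ε * m) m|
        + |pairForceCoeff (α + 1) f x (ε * m) m| := by
      simpa using abs_add_le (T ε m - pairForceCoeff (α + 1) f x (ε * m) m)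
        (pairForceCoeff (α + 1) f x (ε * m) m)
    refine h3.trans ((add_le_add h1 h2).trans ?_)
    have hw : 0 ≤ (m : ℝ) ^ (-(α + 1)) := by have := hmpos m; positivity
    rw [← hpow3, ← mul_add, mul_left_comm K]
    refine mul_le_mul_of_nonneg_left ?_ hw
    have e1 : C * ε ^ 2 * m ≤ C * 1 * (m : ℝ) ^ 3 := by gcongr
    have e2 : (α + 1) * (α + 1 + 1) / 2 * m * (2 * B) * (B + B)
        ≤ (α + 1) * (α + 1 + 1) / 2 * (m : ℝ) ^ 3 * (2 * B) * (B + B) := by gcongr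
    simp only [K]
    linarith
  have hev : ∀ᶠ ε : ℝ in 𝓝[>] 0, 0 < ε ∧ ε ≤ 1 ∧ ε ^ 2 * B ≤ 1 / 2 := by
    have hcont : Tendsto (fun ε : ℝ => ε ^ 2 * B) (𝓝[>] 0) (𝓝 0) := by
      have : Continuous fun ε : ℝ => ε ^ 2 * B := by fun_prop
      simpa using (this.tendsto 0).mono_left nhdsWithin_le_nhds
    filter_upwards [self_mem_nhdsWithin, hcont.eventually_le_const (by norm_num : (0 : ℝ) < 1 / 2),
      Ioc_mem_nhdsGT (zero_lt_one (α := ℝ))] with ε h1 h2 h3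
    exact ⟨h1, h3.2, h2⟩
  have hptwise : ∀ m : ℕ+, Tendsto (fun ε => T ε m) (𝓝[>] 0)
      (𝓝 ((m : ℝ) ^ (-(α + 1)) * (-(α + 1) * (m : ℝ) ^ 3 * (iteratedDeriv 4 f x / 12)
        + (α + 1) * (α + 1 + 1) / 2 * m * iteratedDeriv 2 f x
          * (iteratedDeriv 1 f x + iteratedDeriv 1 f x)))) := fun m => by
    have hdiff : Tendsto (fun ε => T ε m - pairForceCoeff (α + 1) f x (ε * m) m)
        (𝓝[>] 0) (𝓝 0) := by
      have hlim : Tendsto (fun ε : ℝ => (m : ℝ) ^ (-(α + 1)) * (C * ε ^ 2 * m))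
          (𝓝[>] 0) (𝓝 0) := by
        have : Continuous fun ε : ℝ => (m : ℝ) ^ (-(α + 1)) * (C * ε ^ 2 * m) := by fun_prop
        simpa using (this.tendsto 0).mono_left nhdsWithin_le_nhds
      refine squeeze_zero_norm' ?_ hlim
      filter_upwards [hev] with ε hε
      exact hT ε hε.1 hε.2.2 m
    simpa using hdiff.add (tendsto_pairForceCoeff (α + 1) hB hf hb x m)
  have hlim := tendsto_tsum_of_dominated_convergence (hζ2.summable.mul_left K) hptwise (by
    filter_upwards [hev] with ε hε m
    exact hbound ε hε.1 hε.2.1 hε.2.2 m)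
  have hvalue : HasSum (fun m : ℕ+ => (m : ℝ) ^ (-(α + 1)) *
      (-(α + 1) * (m : ℝ) ^ 3 * (iteratedDeriv 4 f x / 12)
        + (α + 1) * (α + 1 + 1) / 2 * m * iteratedDeriv 2 f x
          * (iteratedDeriv 1 f x + iteratedDeriv 1 f x)))
      (-(α + 1) * zetaR (α - 2) * (iteratedDeriv 4 f x / 12)
        + (α + 1) * (α + 2) * zetaR α * iteratedDeriv 1 f x * iteratedDeriv 2 f x) := by
    have h := (hζ2.mul_left (-(α + 1) * (iteratedDeriv 4 f x / 12))).add
      (hζ.mul_left ((α + 1) * (α + 2) * iteratedDeriv 1 f x * iteratedDeriv 2 f x))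
    rw [mul_right_comm, mul_right_comm _ (zetaR α), mul_right_comm _ (zetaR α)]
    refine h.congr_fun fun m => ?_
    rw [← hpow1, ← hpow3]
    ring
  rw [hvalue.tsum_eq] at hlim
  refine hlim.congr' ?_
  filter_upwards [hev] with ε ⟨hε, hε1, hεB⟩
  have hTsum : Summable (T ε) := (hζ2.summable.mul_left K).of_norm_bounded
    (hbound ε hε hε1 hεB)
  have hlin : HasSum (fun m : ℕ+ => (α + 1) * (m : ℝ) ^ (-α) * ε ^ 3 * iteratedDeriv 2 f x)
      ((α + 1) * zetaR α * ε ^ 3 * iteratedDeriv 2 f x) :=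
    ((hζ.mul_left (α + 1)).mul_right (ε ^ 3)).mul_right _
  have hforce : HasSum (fun m : ℕ+ => pairForce (α + 1) f x ε m)
      (ε ^ 5 * (∑' m, T ε m) - (α + 1) * zetaR α * ε ^ 3 * iteratedDeriv 2 f x) := by
    refine ((hTsum.hasSum.mul_left (ε ^ 5)).sub hlin).congr_fun fun m => ?_
    simp only [T]
    field_simp
    ring
  rw [hforce.tsum_eq]
  field_simp
  ring

theorem zetaR_nonneg (s : ℝ) : 0 ≤ zetaR s :=
  tsum_nonneg fun m => by positivity

/-- Derivative of a directional derivative along an affine line. -/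
theorem hasDerivAt_fderiv_apply_line {V : ℝ × ℝ → ℝ} (hV : ContDiff ℝ (⊤ : ℕ∞) V)
    (w a b : ℝ × ℝ) (t : ℝ) :
    HasDerivAt (fun t : ℝ => fderiv ℝ V (a + t • b) w)
      (fderiv ℝ (fderiv ℝ V) (a + t • b) b w) t := by
  have hline : HasDerivAt (fun t : ℝ => a + t • b) b t := by
    simpa using ((hasDerivAt_id t).smul_const b).const_add a
  have hdiff : DifferentiableAt ℝ (fderiv ℝ V) (a + t • b) :=
    (hV.fderiv_right (m := (⊤ : ℕ∞)) (by simp)).differentiable (by simp) _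
  have h := hdiff.hasFDerivAt.comp_hasDerivAt t hline
  simpa using h.clm_apply (hasDerivAt_const t w)

theorem hasDerivAt_comp_line {V : ℝ × ℝ → ℝ} (hV : ContDiff ℝ (⊤ : ℕ∞) V)
    (a b : ℝ × ℝ) (t : ℝ) :
    HasDerivAt (fun t : ℝ => V (a + t • b)) (fderiv ℝ V (a + t • b) b) t := by
  have hline : HasDerivAt (fun t : ℝ => a + t • b) b t := by
    simpa using ((hasDerivAt_id t).smul_const b).const_add a
  exact (hV.differentiable (by simp) _).hasFDerivAt.comp_hasDerivAt t hline

theorem iteratedDeriv_two_comp_line {V : ℝ × ℝ → ℝ} (hV : ContDiff ℝ (⊤ : ℕ∞) V)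
    (a b : ℝ × ℝ) (t : ℝ) :
    iteratedDeriv 2 (fun t : ℝ => V (a + t • b)) t = fderiv ℝ (fderiv ℝ V) (a + t • b) b b := by
  rw [iteratedDeriv_succ, iteratedDeriv_one,
    show deriv (fun t : ℝ => V (a + t • b)) = fun t => fderiv ℝ V (a + t • b) b from
      funext fun t => (hasDerivAt_comp_line hV a b t).deriv]
  exact (hasDerivAt_fderiv_apply_line hV b a b t).deriv

theorem fderiv_fderiv_apply_self {V : ℝ × ℝ → ℝ} (hV : ContDiff ℝ (⊤ : ℕ∞) V)
    (z : ℝ × ℝ) (r s : ℝ) :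
    fderiv ℝ (fderiv ℝ V) z (r, s) (r, s)
      = r ^ 2 * fderiv ℝ (fderiv ℝ V) z (1, 0) (1, 0)
        + 2 * r * s * fderiv ℝ (fderiv ℝ V) z (0, 1) (1, 0)
        + s ^ 2 * fderiv ℝ (fderiv ℝ V) z (0, 1) (0, 1) := by
  have hsymm : fderiv ℝ (fderiv ℝ V) z (1, 0) (0, 1) = fderiv ℝ (fderiv ℝ V) z (0, 1) (1, 0) :=
    (hV.contDiffAt.isSymmSndFDerivAt (by
      simpa using WithTop.coe_le_coe.2 (le_top : (2 : ℕ∞) ≤ ⊤))).eq _ _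
  rw [show ((r, s) : ℝ × ℝ) = r • ((1, 0) : ℝ × ℝ) + s • ((0, 1) : ℝ × ℝ) by simp]
  simp only [map_add, map_smul, add_apply, smul_apply, smul_eq_mul, hsymm]
  ring

/-- The acceleration of the long-wave ansatz in the KdV scaling. -/
theorem iteratedDeriv_two_ansatz {α : ℝ} {v : ℝ → ℝ → ℝ}
    (hV : ContDiff ℝ (⊤ : ℕ∞) (Function.uncurry v)) {ε : ℝ} (hε : ε ≠ 0) (x τ : ℝ) :
    iteratedDeriv 2 (fun t' => ansatz α 1 3 v ε
        (x / ε + sonicSpeed α * (τ / ε ^ (3 : ℝ))) t') (τ / ε ^ (3 : ℝ))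
      = ε ^ 3 * sonicSpeed α ^ 2 * iteratedDeriv 2 (fun x' => v x' τ) x
        - 2 * sonicSpeed α * ε ^ 5 * deriv (fun τ' => deriv (fun x' => v x' τ') x) τ
        + ε ^ 7 * fderiv ℝ (fderiv ℝ (Function.uncurry v)) (x, τ) (0, 1) (0, 1) := by
  have h3 : ε ^ (3 : ℝ) = ε ^ 3 := by exact_mod_cast Real.rpow_natCast ε 3
  have hspace : (fun x' => v x' τ)
      = fun t : ℝ => Function.uncurry v ((0, τ) + t • ((1, 0) : ℝ × ℝ)) := by
    funext x'; simp
  have hxx : iteratedDeriv 2 (fun x' => v x' τ) x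
      = fderiv ℝ (fderiv ℝ (Function.uncurry v)) (x, τ) (1, 0) (1, 0) := by
    rw [hspace, iteratedDeriv_two_comp_line hV]
    simp
  have hx : ∀ τ', deriv (fun x' => v x' τ') x
      = fderiv ℝ (Function.uncurry v) ((x, 0) + τ' • ((0, 1) : ℝ × ℝ)) (1, 0) := fun τ' => by
    have h := (hasDerivAt_comp_line hV (0, τ') (1, 0) x).deriv
    simpa using h
  have hxτ : deriv (fun τ' => deriv (fun x' => v x' τ') x) τ
      = fderiv ℝ (fderiv ℝ (Function.uncurry v)) (x, τ) (0, 1) (1, 0) := by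
    simp_rw [hx]
    rw [(hasDerivAt_fderiv_apply_line hV (1, 0) (x, 0) (0, 1) τ).deriv]
    simp
  generalize hj : x / ε + sonicSpeed α * (τ / ε ^ (3 : ℝ)) = j
  have hline : (fun t' => ansatz α 1 3 v ε j t') = fun t' => j + ε * Function.uncurry v
      ((ε * j, 0) + t' • ((-(ε * sonicSpeed α), ε ^ 3) : ℝ × ℝ)) := by
    funext t'
    simp only [ansatz, h3, Real.rpow_one, Prod.smul_mk, Prod.mk_add_mk, Function.uncurry_apply_pair,
      smul_eq_mul]
    ring_nf
  have hpoint : ((ε * j, 0) : ℝ × ℝ) + (τ / ε ^ 3) • ((-(ε * sonicSpeed α), ε ^ 3) : ℝ × ℝ)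
      = (x, τ) := by
    rw [← hj, h3]
    ext
    · simp; field_simp; ring
    · simp; field_simp
  rw [hline, iteratedDeriv_const_add (by norm_num), iteratedDeriv_const_mul_field,
    iteratedDeriv_two_comp_line hV, h3, hpoint, fderiv_fderiv_apply_self hV, hxx, hxτ]
  ring

theorem latticeError_eq {α : ℝ} {v : ℝ → ℝ → ℝ}
    (hV : ContDiff ℝ (⊤ : ℕ∞) (Function.uncurry v)) {ε : ℝ} (hε : ε ≠ 0) (x τ : ℝ) :
    latticeError α 1 3 v ε x τ
      = ε ^ 3 * sonicSpeed α ^ 2 * iteratedDeriv 2 (fun x' => v x' τ) x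
        - 2 * sonicSpeed α * ε ^ 5 * deriv (fun τ' => deriv (fun x' => v x' τ') x) τ
        + ε ^ 7 * fderiv ℝ (fderiv ℝ (Function.uncurry v)) (x, τ) (0, 1) (0, 1)
        + α * ∑' m : ℕ+, pairForce (α + 1) (fun x' => v x' τ) x ε m := by
  simp only [latticeError]
  rw [iteratedDeriv_two_ansatz hV hε]
  have h3 : ε ^ (3 : ℝ) = ε ^ 3 := by exact_mod_cast Real.rpow_natCast ε 3
  have hτ : ε ^ 3 * (τ / ε ^ 3) = τ := by field_simp
  congr 2
  refine tsum_congr fun m => ?_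
  simp only [ansatz, pairForce, h3, Real.rpow_one, hτ]
  generalize sonicSpeed α * (τ / ε ^ 3) = c
  rw [show ε * (x / ε + c + m - c) = x + ε * m by field_simp; ring,
    show ε * (x / ε + c - m - c) = x - ε * m by field_simp; ring,
    show ε * (x / ε + c - c) = x by field_simp; ring]
  ring_nf

/-- **KdV scaling limit for power-law lattices, case `α > 3`.**
With `p = 1`, `q = 3`, the lattice error satisfies
`R_ε(x,τ) = ε⁵ Q(x,τ) + o(ε⁵)` as `ε → 0⁺`, where
`Q = κ₁ ∂_τ u + κ₂ u ∂_x u + κ₃ ∂_x³ u`, `u = −∂_x v`. -/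
theorem longwave_KdV (α : ℝ) (hα : 3 < α) (v : ℝ → ℝ → ℝ)
    (hsmooth : ContDiff ℝ (⊤ : ℕ∞) (Function.uncurry v))
    (hL2 : ∃ M : ℝ, ∀ n : ℕ, 1 ≤ n → n ≤ 5 → ∀ τ : ℝ,
      Integrable (fun x : ℝ => (iteratedDeriv n (fun x' => v x' τ) x) ^ 2) ∧
      ∫ x : ℝ, (iteratedDeriv n (fun x' => v x' τ) x) ^ 2 ≤ M)
    (hbdd : ∃ B : ℝ, ∀ n : ℕ, 1 ≤ n → n ≤ 5 → ∀ x τ : ℝ,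
      |iteratedDeriv n (fun x' => v x' τ) x| ≤ B)
    (u : ℝ → ℝ → ℝ) (hu : ∀ x τ : ℝ, u x τ = -(deriv (fun x' => v x' τ) x))
    (κ₁ κ₂ κ₃ : ℝ)
    (hκ₁ : κ₁ = 2 * sonicSpeed α)
    (hκ₂ : κ₂ = α * (α + 1) * (α + 2) * zetaR α)
    (hκ₃ : κ₃ = (1 / 12) * α * (α + 1) * zetaR (α - 2))
    (Q : ℝ → ℝ → ℝ)
    (hQ : ∀ x τ : ℝ, Q x τ = κ₁ * deriv (fun τ' => u x τ') τ
      + κ₂ * u x τ * deriv (fun x' => u x' τ) x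
      + κ₃ * iteratedDeriv 3 (fun x' => u x' τ) x) :
    ∀ x τ : ℝ,
      (fun ε : ℝ => latticeError α 1 3 v ε x τ - ε ^ 5 * Q x τ)
        =o[nhdsWithin 0 (Set.Ioi 0)] (fun ε : ℝ => ε ^ 5) := by
  intro x τ
  obtain ⟨B, hB⟩ := hbdd
  have hB0 : 0 ≤ B := (abs_nonneg _).trans (hB 1 le_rfl (by norm_num) 0 0)
  have hf : ContDiff ℝ (⊤ : ℕ∞) (fun x' => v x' τ) :=
    hsmooth.comp (contDiff_id.prodMk contDiff_const)
  have hlim := tendsto_tsum_pairForce hα hB0 hf (fun n h1 h5 y => hB n h1 h5 y τ) x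
  have hc : sonicSpeed α ^ 2 = α * (α + 1) * zetaR α :=
    Real.sq_sqrt (mul_nonneg (by nlinarith) (zetaR_nonneg α))
  have hux : ∀ n, iteratedDeriv n (fun x' => u x' τ) x
      = -iteratedDeriv (n + 1) (fun x' => v x' τ) x := fun n => by
    rw [show (fun x' => u x' τ) = fun x' => -deriv (fun x' => v x' τ) x' from
      funext fun y => hu y τ, iteratedDeriv_fun_neg, iteratedDeriv_succ']
  have huτ : deriv (fun τ' => u x τ') τ = -deriv (fun τ' => deriv (fun x' => v x' τ') x) τ := by
    simp_rw [hu]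
    exact deriv.fun_neg
  have hQ' : Q x τ = -(2 * sonicSpeed α) * deriv (fun τ' => deriv (fun x' => v x' τ') x) τ
      + α * (-(α + 1) * zetaR (α - 2) * (iteratedDeriv 4 (fun x' => v x' τ) x / 12)
        + (α + 1) * (α + 2) * zetaR α * iteratedDeriv 1 (fun x' => v x' τ) x
          * iteratedDeriv 2 (fun x' => v x' τ) x) := by
    have h1 := hux 1
    have h0 := hux 0
    rw [iteratedDeriv_one] at h1
    rw [iteratedDeriv_zero] at h0
    rw [hQ, huτ, h0, h1, hux 3, hκ₁, hκ₂, hκ₃]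
    ring
  rw [Asymptotics.isLittleO_iff_tendsto' (by
    filter_upwards [self_mem_nhdsWithin] with ε hε h
    exact absurd h (pow_pos hε 5).ne')]
  have hττ : Tendsto (fun ε : ℝ => ε ^ 2 *
      fderiv ℝ (fderiv ℝ (Function.uncurry v)) (x, τ) (0, 1) (0, 1)) (𝓝[>] 0) (𝓝 0) := by
    have : Continuous fun ε : ℝ => ε ^ 2 *
      fderiv ℝ (fderiv ℝ (Function.uncurry v)) (x, τ) (0, 1) (0, 1) := by fun_prop
    simpa using (this.tendsto 0).mono_left nhdsWithin_le_nhds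
  have hsum := hττ.add ((tendsto_sub_nhds_zero_iff.2 hlim).const_mul α)
  rw [mul_zero, add_zero] at hsum
  refine hsum.congr' ?_
  filter_upwards [self_mem_nhdsWithin] with ε hε
  have hε0 : ε ≠ 0 := ne_of_gt hε
  rw [latticeError_eq hsmooth hε0, hQ', hc]
  field_simp
  ring
end
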